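/- There exists an absolute constant K>0 such that for every ψ∈𝔐_∞^+, every β∈ℝ, every (not necessarily convex) modulus of continuity ω, and every n∈ℕ with μ(ψ;n)>2, one has (1/π)·ψ(n)·e_n(ω) − K·γ_n(ψ)·ω(1/n) ≤ E_n(L^ψ_β H_{ω_{L₁}})_{L₁} ≤ (2/π)·ψ(n)·e_n(ω) + K·γ_n(ψ)·ω(1/n). -/

import Mathlib

open Real MeasureTheory Filter

noncomputable section

/-- `ω` is a modulus of continuity: continuous, nondecreasing, subadditive on `[0,∞)`,
nonnegative, and `ω 0 = 0`. -/
def IsModulus (ω : ℝ → ℝ) : Prop :=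
  ContinuousOn ω (Set.Ici 0) ∧ MonotoneOn ω (Set.Ici 0) ∧
  (∀ s t : ℝ, 0 ≤ s → 0 ≤ t → ω (s + t) ≤ ω s + ω t) ∧ ω 0 = 0 ∧
  ∀ t : ℝ, 0 ≤ t → 0 ≤ ω t

/-- `ψ` belongs to `𝔐_∞^+`, where `η t = ψ⁻¹(ψ t / 2)` (i.e. `η t ≥ t` and
`ψ (η t) = ψ t / 2`) and `μ t = t / (η t − t)` is nondecreasing and tends to `∞`. -/
def IsMInfPlus (ψ η : ℝ → ℝ) : Prop :=
  (∀ t ≥ (1:ℝ), 0 < ψ t) ∧ ContinuousOn ψ (Set.Ici 1) ∧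
  ConvexOn ℝ (Set.Ici 1) ψ ∧ Tendsto ψ atTop (nhds 0) ∧
  (∀ t ≥ (1:ℝ), t < η t ∧ ψ (η t) = ψ t / 2) ∧
  MonotoneOn (fun t => t / (η t - t)) (Set.Ici 1) ∧
  Tendsto (fun t => t / (η t - t)) atTop atTop

/-- `T` is a trigonometric polynomial of degree at most `n − 1`. -/
def IsTrigPoly (n : ℕ) (T : ℝ → ℝ) : Prop :=
  ∃ a b : ℕ → ℝ,
    ∀ x, T x = ∑ k ∈ Finset.range n, (a k * Real.cos (k * x) + b k * Real.sin (k * x))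

/-- The kernel `Ψ_β(t) = ∑_{k=1}^∞ ψ(k) cos(kt − βπ/2)`. -/
def PsiKer (ψ : ℝ → ℝ) (β : ℝ) (t : ℝ) : ℝ :=
  ∑' k : ℕ, ψ (k + 1) * Real.cos ((k + 1) * t - β * π / 2)

/-- The class `L^ψ_β H_{ω_{L₁}}`. -/
def L1Class (ψ : ℝ → ℝ) (β : ℝ) (ω : ℝ → ℝ) : Set (ℝ → ℝ) :=
  {f | IntervalIntegrable f volume (-π) π ∧ Function.Periodic f (2 * π) ∧
    ∃ a₀ : ℝ, ∃ φ : ℝ → ℝ, IntervalIntegrable φ volume (-π) π ∧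
      Function.Periodic φ (2 * π) ∧
      (∫ t in (-π)..π, φ t) = 0 ∧
      (∀ t : ℝ, 0 ≤ t → ∀ h : ℝ, |h| ≤ t →
        (∫ x in (-π)..π, |φ (x + h) - φ x|) ≤ ω t) ∧
      ∀ᵐ x : ℝ, f x = a₀ / 2 + (1 / π) * ∫ t in (-π)..π, φ (x - t) * PsiKer ψ β t}

/-- Best `L₁` approximation of `f` by trigonometric polynomials of degree `≤ n − 1`. -/
def EnL1 (n : ℕ) (f : ℝ → ℝ) : ℝ :=
  sInf {e | ∃ T : ℝ → ℝ, IsTrigPoly n T ∧ e = ∫ x in (-π)..π, |f x - T x|}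

/-- Best `L₁` approximation of a class of functions. -/
def EnL1Class (n : ℕ) (N : Set (ℝ → ℝ)) : ℝ := sSup (EnL1 n '' N)

/-- `e_n(ω) = ∫_0^{π/2} ω(2t/n) sin t dt`. -/
def eN (n : ℕ) (ω : ℝ → ℝ) : ℝ := ∫ t in (0:ℝ)..(π / 2), ω (2 * t / n) * Real.sin t

/-- `γ_n(ψ) = ψ(n+1)(1/n + 1/(μ(n)−2)) + ψ(3n)(1 + ln⁺(η(n)−n))`. -/
def gammaN (ψ η : ℝ → ℝ) (n : ℕ) : ℝ :=
  ψ (n + 1) * (1 / n + 1 / ((n : ℝ) / (η n - n) - 2)) +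
    ψ (3 * n) * (1 + max 0 (Real.log (η n - n)))

lemma IsTrigPoly.add {n : ℕ} {S T : ℝ → ℝ} (hS : IsTrigPoly n S) (hT : IsTrigPoly n T) :
    IsTrigPoly n (fun x => S x + T x) := by
  obtain ⟨a, b, h⟩ := hS
  obtain ⟨a', b', h'⟩ := hT
  refine ⟨fun k => a k + a' k, fun k => b k + b' k, fun x => ?_⟩
  beta_reduce
  rw [h, h', ← Finset.sum_add_distrib]
  refine Finset.sum_congr rfl fun k _ => ?_
  ring

lemma IsTrigPoly.smul {n : ℕ} {S : ℝ → ℝ} (c : ℝ) (hS : IsTrigPoly n S) :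
    IsTrigPoly n (fun x => c * S x) := by
  obtain ⟨a, b, h⟩ := hS
  refine ⟨fun k => c * a k, fun k => c * b k, fun x => ?_⟩
  beta_reduce
  rw [h, Finset.mul_sum]
  refine Finset.sum_congr rfl fun k _ => ?_
  ring

lemma IsTrigPoly.zero {n : ℕ} : IsTrigPoly n (fun _ => 0) :=
  ⟨fun _ => 0, fun _ => 0, fun x => by simp⟩

lemma IsTrigPoly.sum {n : ℕ} {ι : Type*} (s : Finset ι) (F : ι → ℝ → ℝ)
    (h : ∀ i ∈ s, IsTrigPoly n (F i)) : IsTrigPoly n (fun x => ∑ i ∈ s, F i x) := by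
  classical
  induction s using Finset.induction_on with
  | empty => simpa using IsTrigPoly.zero
  | insert i s hi ih =>
    have h1 := (h i (Finset.mem_insert_self _ _)).add
      (ih fun j hj => h j (Finset.mem_insert_of_mem hj))
    simpa [Finset.sum_insert hi] using h1

lemma IsTrigPoly.cosN {n k : ℕ} (hk : k < n) (α : ℝ) :
    IsTrigPoly n (fun x => Real.cos (k * x + α)) := by
  refine ⟨fun j => if j = k then Real.cos α else 0, fun j => if j = k then - Real.sin α else 0,
    fun x => ?_⟩
  rw [Finset.sum_eq_single k]
  · simp [Real.cos_add]; ring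
  · intro j _ hj; simp [hj]
  · intro h; simp at h; omega

lemma IsTrigPoly.cosZ {n : ℕ} {k : ℤ} (hk : |k| < n) (α : ℝ) :
    IsTrigPoly n (fun x => Real.cos (k * x + α)) := by
  have h1 : k.natAbs < n := by
    have := abs_lt.mp hk
    omega
  rcases Int.natAbs_eq k with h | h
  · have := IsTrigPoly.cosN h1 α
    have e : (k : ℝ) = (k.natAbs : ℝ) := by
      conv_lhs => rw [h]
      simp
    rw [e]; exact this
  · have := IsTrigPoly.cosN h1 (-α)
    have e : (k : ℝ) = -(k.natAbs : ℝ) := by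
      conv_lhs => rw [h]
      simp
    rw [e]
    convert this using 2 with x
    rw [← Real.cos_neg]; ring_nf

lemma IsTrigPoly.cosSub {n k : ℕ} (hk : k < n) (α : ℝ) :
    IsTrigPoly n (fun x => Real.cos (k * x - α)) := by
  simpa [sub_eq_add_neg] using IsTrigPoly.cosN hk (-α)

lemma IsTrigPoly.const {n : ℕ} (hn : 1 ≤ n) (c : ℝ) : IsTrigPoly n (fun _ => c) := by
  have := (IsTrigPoly.cosN (n := n) (k := 0) (by omega) 0).smul c
  simpa using this

lemma IsTrigPoly.continuous {n : ℕ} {S : ℝ → ℝ} (hS : IsTrigPoly n S) : Continuous S := by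
  obtain ⟨a, b, h⟩ := hS
  have : S = fun x => ∑ k ∈ Finset.range n, (a k * Real.cos (k * x) + b k * Real.sin (k * x)) :=
    funext h
  rw [this]; fun_prop

lemma IsTrigPoly.periodic {n : ℕ} {S : ℝ → ℝ} (hS : IsTrigPoly n S) :
    Function.Periodic S (2 * π) := by
  obtain ⟨a, b, h⟩ := hS
  intro x
  rw [h, h]
  refine Finset.sum_congr rfl fun k _ => ?_
  have e : (k : ℝ) * (x + 2 * π) = k * x + k * (2 * π) := by ring
  rw [e, Real.cos_add_nat_mul_two_pi, Real.sin_add_nat_mul_two_pi]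

/-- orthogonality -/
lemma int_cos_int (k : ℤ) (hk : k ≠ 0) (α : ℝ) :
    ∫ t in (-π)..π, Real.cos (k * t + α) = 0 := by
  have hk' : (k : ℝ) ≠ 0 := by exact_mod_cast hk
  rw [intervalIntegral.integral_comp_mul_add (fun y => Real.cos y) hk' α]
  rw [integral_cos]
  have : Real.sin (k * π + α) = Real.sin (k * -π + α) := by
    have := Real.sin_add_int_mul_two_pi (k * -π + α) k
    rw [← this]; ring_nf
  rw [this]; simp

/-- Fejér kernel (unnormalised) -/
def DD (w : ℕ) (t : ℝ) : ℝ :=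
  (∑ j ∈ Finset.range w, Real.cos (j * t)) ^ 2 + (∑ j ∈ Finset.range w, Real.sin (j * t)) ^ 2

lemma DD_nonneg (w : ℕ) (t : ℝ) : 0 ≤ DD w t := by unfold DD; positivity

lemma DD_cont (w : ℕ) : Continuous (DD w) := by unfold DD; fun_prop

lemma DD_periodic (w : ℕ) : Function.Periodic (DD w) (2 * π) := by
  intro x
  unfold DD
  have e : ∀ k : ℕ, (k : ℝ) * (x + 2 * π) = k * x + k * (2 * π) := fun k => by ring
  simp only [e, Real.cos_add_nat_mul_two_pi, Real.sin_add_nat_mul_two_pi]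

lemma DD_double (w : ℕ) (t : ℝ) : DD w t = ∑ p ∈ Finset.range w ×ˢ Finset.range w,
    Real.cos (((p.1 : ℤ) - (p.2 : ℤ) : ℤ) * t) := by
  unfold DD
  rw [pow_two, pow_two, Finset.sum_mul_sum, Finset.sum_mul_sum, Finset.sum_product,
    ← Finset.sum_add_distrib]
  refine Finset.sum_congr rfl fun i _ => ?_
  rw [← Finset.sum_add_distrib]
  refine Finset.sum_congr rfl fun j _ => ?_
  push_cast
  rw [sub_mul, Real.cos_sub]

lemma DD_integral (w : ℕ) : ∫ t in (-π)..π, DD w t = 2 * π * w := by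
  simp_rw [DD_double]
  rw [intervalIntegral.integral_finsetSum]
  · rw [Finset.sum_product]
    have : ∀ i ∈ Finset.range w, ∑ j ∈ Finset.range w,
        ∫ t in (-π)..π, Real.cos (((i : ℤ) - (j : ℤ) : ℤ) * t) = 2 * π := by
      intro i hi
      rw [Finset.sum_eq_single i]
      · simp; ring
      · intro j _ hj
        have := int_cos_int ((i : ℤ) - (j : ℤ)) (by omega) 0
        simpa using this
      · intro h; exact absurd hi h
    rw [Finset.sum_congr rfl this]
    simp; ring
  · intro i _
    exact (by fun_prop : Continuous _).intervalIntegrable _ _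

lemma DD_succ (w : ℕ) (t : ℝ) :
    DD (w + 1) t = DD w t + (1 + 2 * ∑ j ∈ Finset.range w, Real.cos ((j + 1 : ℕ) * t)) := by
  unfold DD
  rw [Finset.sum_range_succ, Finset.sum_range_succ]
  have h : ∑ j ∈ Finset.range w, Real.cos ((j + 1 : ℕ) * t) =
      ∑ j ∈ Finset.range w, (Real.cos (w * t) * Real.cos (j * t)
        + Real.sin (w * t) * Real.sin (j * t)) := by
    rw [← Finset.sum_range_reflect]
    refine Finset.sum_congr rfl fun j hj => ?_
    rw [Finset.mem_range] at hj
    rw [← Real.cos_sub]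
    congr 1
    have : ((w - 1 - j + 1 : ℕ) : ℝ) = w - j := by
      rw [show w - 1 - j + 1 = w - j by omega, Nat.cast_sub hj.le]
    rw [this]; ring
  rw [h, Finset.sum_add_distrib, ← Finset.mul_sum, ← Finset.mul_sum]
  nlinarith [Real.sin_sq_add_cos_sq (w * t)]

lemma DD_sin (w : ℕ) (t : ℝ) : DD w t * Real.sin (t / 2) ^ 2 = Real.sin (w * t / 2) ^ 2 := by
  -- first the Dirichlet identity
  have dir : ∀ w : ℕ, (1 + 2 * ∑ j ∈ Finset.range w, Real.cos ((j + 1 : ℕ) * t)) * Real.sin (t/2)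
      = Real.sin ((2 * w + 1) * t / 2) := by
    intro w
    induction w with
    | zero => simp
    | succ w ih =>
      rw [Finset.sum_range_succ]
      have e1 : (2 * ((w + 1 : ℕ) : ℝ) + 1) * t / 2 = (w + 1 : ℕ) * t + t / 2 := by
        push_cast; ring
      have e2 : (2 * (w : ℝ) + 1) * t / 2 = (w + 1 : ℕ) * t - t / 2 := by push_cast; ring
      rw [e1, Real.sin_add]
      rw [e2, Real.sin_sub] at ih
      linear_combination ih
  induction w with
  | zero => simp [DD]
  | succ w ih =>
    rw [DD_succ, add_mul, ih]
    have := dir w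
    have e1 : (2 * (w : ℝ) + 1) * t / 2 = (w * t / 2) + ((w + 1 : ℕ) * t / 2) := by
      push_cast; ring
    have e2 : t / 2 = ((w + 1 : ℕ) * t / 2) - w * t / 2 := by push_cast; ring
    have h3 : (1 + 2 * ∑ j ∈ Finset.range w, Real.cos ((j + 1 : ℕ) * t)) * Real.sin (t/2) ^ 2 =
       Real.sin ((2 * w + 1) * t / 2) * Real.sin (t/2) := by rw [← this]; ring
    rw [h3, e1]
    conv_lhs => rw [e2]
    rw [Real.sin_add, Real.sin_sub]
    set a := (w : ℝ) * t / 2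
    set b := ((w + 1 : ℕ) : ℝ) * t / 2
    have ha := Real.sin_sq_add_cos_sq a
    have hb := Real.sin_sq_add_cos_sq b
    have ha' : Real.cos a ^ 2 = 1 - Real.sin a ^ 2 := by linarith
    have hb' : Real.cos b ^ 2 = 1 - Real.sin b ^ 2 := by linarith
    ring_nf
    rw [ha', hb']; ring

/-- periodic and integrable over a period -/
structure PI (φ : ℝ → ℝ) : Prop where
  ii : IntervalIntegrable φ volume (-π) π
  per : Function.Periodic φ (2 * π)

/-- bounded measurable kernel -/
structure Nice (K : ℝ → ℝ) : Prop where
  meas : Measurable K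
  bdd : ∃ M, ∀ t, |K t| ≤ M

lemma PI.all {φ : ℝ → ℝ} (h : PI φ) (a b : ℝ) : IntervalIntegrable φ volume a b := by
  refine h.per.intervalIntegrable (t := -π) (by positivity) ?_ a b
  have : -π + 2 * π = π := by ring
  rw [this]; exact h.ii

lemma PI.loc {φ : ℝ → ℝ} (h : PI φ) : LocallyIntegrable φ volume := by
  intro x
  refine ⟨Set.Ioc (x - 1) (x + 1), Ioc_mem_nhds (by linarith) (by linarith), ?_⟩
  have := h.all (x - 1) (x + 1)
  rwa [intervalIntegrable_iff_integrableOn_Ioc_of_le (by linarith)] at this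

lemma PI.aesm {φ : ℝ → ℝ} (h : PI φ) : AEStronglyMeasurable φ volume :=
  h.loc.aestronglyMeasurable

lemma per_shift {F : ℝ → ℝ} (hF : Function.Periodic F (2 * π)) (c : ℝ) :
    ∫ x in (-π)..π, F (x + c) = ∫ x in (-π)..π, F x := by
  rw [intervalIntegral.integral_comp_add_right]
  have := hF.intervalIntegral_add_eq (-π + c) (-π)
  rw [show -π + 2 * π = π by ring, show -π + c + 2 * π = π + c by ring] at this
  exact this

lemma per_shift' {F : ℝ → ℝ} (hF : Function.Periodic F (2 * π)) (a : ℝ) :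
    ∫ x in (-π)..π, F x = ∫ x in a..(a + 2 * π), F x := by
  have := hF.intervalIntegral_add_eq (-π) a
  rw [show -π + 2 * π = π by ring] at this
  exact this

lemma per_refl {F : ℝ → ℝ} (hF : Function.Periodic F (2 * π)) (c : ℝ) :
    ∫ x in (-π)..π, F (c - x) = ∫ x in (-π)..π, F x := by
  rw [intervalIntegral.integral_comp_sub_left, per_shift' hF (c - π)]
  congr 1; ring

lemma PI.shift {φ : ℝ → ℝ} (h : PI φ) (c : ℝ) : PI (fun x => φ (x + c)) := by
  refine ⟨?_, ?_⟩
  · have := (h.all (-π + c) (π + c)).comp_add_right c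
    simpa using this
  · intro x; simp only []; rw [show x + 2 * π + c = x + c + 2 * π by ring, h.per]

lemma PI.sub {φ χ : ℝ → ℝ} (h : PI φ) (h' : PI χ) : PI (fun x => φ x - χ x) :=
  ⟨h.ii.sub h'.ii, fun x => by simp only [h.per x, h'.per x]⟩

lemma PI.abs_per {φ : ℝ → ℝ} (h : PI φ) : Function.Periodic (fun x => |φ x|) (2 * π) :=
  fun x => by simp only [h.per x]

lemma negpi_le : -π ≤ π := by linarith [Real.pi_pos]

lemma prodInt {φ : ℝ → ℝ} (h : PI φ) {a b : ℝ} (b₀ c : ℝ) {k : ℝ → ℝ} (hk : Nice k) :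
    Integrable (fun p : ℝ × ℝ => φ (p.1 + b₀ * p.2 + c) * k p.2)
      ((volume.restrict (Set.Ioc (-π) π)).prod (volume.restrict (Set.Ioc a b))) := by
  obtain ⟨M, hM⟩ := hk.bdd
  have hq : Measure.QuasiMeasurePreserving (fun p : ℝ × ℝ => p.1 + b₀ * p.2 + c)
      ((volume.restrict (Set.Ioc (-π) π)).prod (volume.restrict (Set.Ioc a b))) volume := by
    refine QuasiMeasurePreserving.prod_of_left (by fun_prop)
      (Eventually.of_forall fun y => ?_)
    have h1 : Measure.QuasiMeasurePreserving (fun x : ℝ => x + (b₀ * y + c)) volume volume :=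
      (measurePreserving_add_right volume _).quasiMeasurePreserving
    have h2 := h1.mono_left (Measure.absolutelyContinuous_of_le
      (Measure.restrict_le_self (μ := (volume : Measure ℝ)) (s := Set.Ioc (-π) π)))
    simpa [add_assoc] using h2
  have hm : AEStronglyMeasurable (fun p : ℝ × ℝ => φ (p.1 + b₀ * p.2 + c) * k p.2)
      ((volume.restrict (Set.Ioc (-π) π)).prod (volume.restrict (Set.Ioc a b))) := by
    refine (h.aesm.comp_quasiMeasurePreserving hq).mul ?_
    exact (hk.meas.comp measurable_snd).aestronglyMeasurable
  rw [integrable_prod_iff' hm]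
  constructor
  · refine Eventually.of_forall fun y => ?_
    have := ((h.shift (b₀ * y + c)).ii).mul_const (k y)
    rw [intervalIntegrable_iff_integrableOn_Ioc_of_le negpi_le] at this
    simpa [add_assoc, IntegrableOn] using this
  · have : (fun y => ∫ x, ‖φ ((x, y) : ℝ × ℝ).1‖ * 0 ∂(volume.restrict (Set.Ioc (-π) π))) =
        fun y => 0 := by simp
    have e : (fun y => ∫ x in Set.Ioc (-π) π, ‖φ (x + b₀ * y + c) * k y‖) =
        fun y => (∫ x in (-π)..π, |φ x|) * |k y| := by
      funext y
      rw [← intervalIntegral.integral_of_le negpi_le, ← per_shift h.abs_per (b₀ * y + c),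
        ← intervalIntegral.integral_mul_const]
      simp [add_assoc]
    simp only [e]
    refine Integrable.const_mul ?_ _
    refine Integrable.mono' (integrable_const M) ?_ ?_
    · exact (hk.meas.norm).aestronglyMeasurable
    · exact Eventually.of_forall fun y => by simpa using hM y

lemma mink {H : ℝ → ℝ → ℝ} {a b : ℝ} (hab : a ≤ b)
    (hH : Integrable (fun p : ℝ × ℝ => H p.1 p.2)
      ((volume.restrict (Set.Ioc (-π) π)).prod (volume.restrict (Set.Ioc a b)))) :
    ∫ x in (-π)..π, |∫ s in a..b, H x s| ≤ ∫ s in a..b, ∫ x in (-π)..π, |H x s| := by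
  simp only [intervalIntegral.integral_of_le negpi_le, intervalIntegral.integral_of_le hab]
  have hn := hH.norm
  rw [integral_integral_swap (f := fun s x => |H x s|)]
  · refine integral_mono_of_nonneg (Eventually.of_forall fun x => abs_nonneg _) ?_ ?_
    · exact hn.integral_prod_left
    · exact Eventually.of_forall fun x => abs_integral_le_integral_abs
  · exact hn.swap

lemma mink_ii {H : ℝ → ℝ → ℝ} {a b : ℝ} (hab : a ≤ b)
    (hH : Integrable (fun p : ℝ × ℝ => H p.1 p.2)
      ((volume.restrict (Set.Ioc (-π) π)).prod (volume.restrict (Set.Ioc a b)))) :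
    IntervalIntegrable (fun x => ∫ s in a..b, H x s) volume (-π) π := by
  simp only [intervalIntegral.integral_of_le hab]
  rw [intervalIntegrable_iff_integrableOn_Ioc_of_le negpi_le]
  exact hH.integral_prod_left

/-- convolution over a period -/
def cv (φ K : ℝ → ℝ) (x : ℝ) : ℝ := ∫ t in (-π)..π, φ (x - t) * K t

lemma cv_prod {φ K : ℝ → ℝ} (h : PI φ) (hK : Nice K) :
    Integrable (fun p : ℝ × ℝ => φ (p.1 - p.2) * K p.2)
      ((volume.restrict (Set.Ioc (-π) π)).prod (volume.restrict (Set.Ioc (-π) π))) := by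
  have := prodInt h (a := -π) (b := π) (-1) 0 hK
  simpa [sub_eq_add_neg] using this

lemma cv_PI {φ K : ℝ → ℝ} (h : PI φ) (hK : Nice K) : PI (cv φ K) := by
  refine ⟨mink_ii (H := fun x t => φ (x - t) * K t) negpi_le (cv_prod h hK), fun x => ?_⟩
  unfold cv
  refine intervalIntegral.integral_congr fun t _ => ?_
  rw [show x + 2 * π - t = x - t + 2 * π by ring, h.per]

lemma cv_norm {φ K : ℝ → ℝ} (h : PI φ) (hK : Nice K) :
    ∫ x in (-π)..π, |cv φ K x| ≤ (∫ x in (-π)..π, |φ x|) * ∫ t in (-π)..π, |K t| := by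
  refine (mink (H := fun x t => φ (x - t) * K t) negpi_le (cv_prod h hK)).trans ?_
  rw [← intervalIntegral.integral_const_mul]
  apply le_of_eq
  refine intervalIntegral.integral_congr fun t _ => ?_
  simp only [abs_mul, intervalIntegral.integral_mul_const]
  congr 1
  simpa [sub_eq_add_neg] using per_shift h.abs_per (-t)

lemma Nice.ii {K : ℝ → ℝ} (hK : Nice K) (a b : ℝ) : IntervalIntegrable K volume a b := by
  obtain ⟨M, hM⟩ := hK.bdd
  refine (intervalIntegrable_const (c := M)).mono_fun hK.meas.aestronglyMeasurable ?_
  refine Eventually.of_forall fun t => ?_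
  simp only [Real.norm_eq_abs]
  exact (hM t).trans (le_abs_self M)

lemma PI.mul_nice {φ K : ℝ → ℝ} (h : PI φ) (hK : Nice K) (x a b : ℝ) :
    IntervalIntegrable (fun t => φ (x - t) * K t) volume a b := by
  obtain ⟨M, hM⟩ := hK.bdd
  have h1 : IntervalIntegrable (fun t => φ (x - t)) volume a b := by
    have := (h.all (x - a) (x - b)).comp_sub_left x
    simpa using this
  have h2 : IntervalIntegrable (fun t => M * φ (x - t)) volume a b := h1.const_mul M
  refine h2.mono_fun (h1.aestronglyMeasurable_restrict_uIoc.mul hK.meas.aestronglyMeasurable) ?_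
  refine Eventually.of_forall fun t => ?_
  simp only [norm_mul, Real.norm_eq_abs]
  rw [mul_comm]
  exact mul_le_mul_of_nonneg_right ((hM t).trans (le_abs_self M)) (abs_nonneg _)

lemma cv_add {φ K L : ℝ → ℝ} (h : PI φ) (hK : Nice K) (hL : Nice L) (x : ℝ) :
    cv φ (fun t => K t + L t) x = cv φ K x + cv φ L x := by
  unfold cv
  rw [← intervalIntegral.integral_add (h.mul_nice hK x _ _) (h.mul_nice hL x _ _)]
  simp only [mul_add]

lemma cv_smul {φ K : ℝ → ℝ} (c : ℝ) (x : ℝ) :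
    cv φ (fun t => c * K t) x = c * cv φ K x := by
  unfold cv
  rw [← intervalIntegral.integral_const_mul]
  refine intervalIntegral.integral_congr fun t _ => ?_
  simp only []; ring

lemma cv_sub_left {φ χ K : ℝ → ℝ} (h : PI φ) (h' : PI χ) (hK : Nice K) (x : ℝ) :
    cv (fun x => φ x - χ x) K x = cv φ K x - cv χ K x := by
  unfold cv
  rw [← intervalIntegral.integral_sub (h.mul_nice hK x _ _) (h'.mul_nice hK x _ _)]
  simp only [sub_mul]

lemma Nice.add {K L : ℝ → ℝ} (hK : Nice K) (hL : Nice L) : Nice (fun t => K t + L t) := by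
  obtain ⟨M, hM⟩ := hK.bdd
  obtain ⟨N, hN⟩ := hL.bdd
  exact ⟨hK.meas.add hL.meas, M + N, fun t => (abs_add_le _ _).trans (add_le_add (hM t) (hN t))⟩

lemma Nice.mul {K L : ℝ → ℝ} (hK : Nice K) (hL : Nice L) : Nice (fun t => K t * L t) := by
  obtain ⟨M, hM⟩ := hK.bdd
  obtain ⟨N, hN⟩ := hL.bdd
  refine ⟨hK.meas.mul hL.meas, M * N, fun t => ?_⟩
  rw [abs_mul]
  exact mul_le_mul (hM t) (hN t) (abs_nonneg _) ((abs_nonneg _).trans (hM t))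

lemma Nice.const (c : ℝ) : Nice (fun _ => c) := ⟨measurable_const, |c|, fun _ => le_rfl⟩

lemma Nice.smul {K : ℝ → ℝ} (c : ℝ) (hK : Nice K) : Nice (fun t => c * K t) :=
  (Nice.const c).mul hK

lemma Nice.sum {ι : Type*} (s : Finset ι) (F : ι → ℝ → ℝ) (h : ∀ i ∈ s, Nice (F i)) :
    Nice (fun t => ∑ i ∈ s, F i t) := by
  classical
  induction s using Finset.induction_on with
  | empty => simpa using Nice.const 0
  | insert i s hi ih =>
    have h1 := (h i (Finset.mem_insert_self _ _)).add
      (ih fun j hj => h j (Finset.mem_insert_of_mem hj))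
    simpa [Finset.sum_insert hi] using h1

lemma Nice.cos (a b : ℝ) : Nice (fun t => Real.cos (a * t - b)) :=
  ⟨by fun_prop, 1, fun t => Real.abs_cos_le_one _⟩

lemma Nice.of_trig {n : ℕ} {T : ℝ → ℝ} (hT : IsTrigPoly n T) : Nice T := by
  refine ⟨hT.continuous.measurable, ?_⟩
  obtain ⟨a, b, h⟩ := hT
  refine ⟨∑ k ∈ Finset.range n, (|a k| + |b k|), fun t => ?_⟩
  rw [h]
  refine (Finset.abs_sum_le_sum_abs _ _).trans (Finset.sum_le_sum fun k _ => ?_)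
  refine (abs_add_le _ _).trans (add_le_add ?_ ?_)
  · rw [abs_mul]; exact mul_le_of_le_one_right (abs_nonneg _) (Real.abs_cos_le_one _)
  · rw [abs_mul]; exact mul_le_of_le_one_right (abs_nonneg _) (Real.abs_sin_le_one _)

lemma Nice.DD (w : ℕ) : Nice (DD w) := by
  refine ⟨(DD_cont w).measurable, ∑ p ∈ Finset.range w ×ˢ Finset.range w, 1, fun t => ?_⟩
  rw [DD_double]
  exact (Finset.abs_sum_le_sum_abs _ _).trans (Finset.sum_le_sum fun k _ => Real.abs_cos_le_one _)

lemma PI.of_trig {n : ℕ} {T : ℝ → ℝ} (hT : IsTrigPoly n T) : PI T :=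
  ⟨hT.continuous.intervalIntegrable _ _, hT.periodic⟩

lemma PI.mul_nice' {φ K : ℝ → ℝ} (h : PI φ) (hK : Nice K) (a b : ℝ) :
    IntervalIntegrable (fun t => φ t * K t) volume a b := by
  have hK' : Nice (fun t => K (-t)) := ⟨hK.meas.comp measurable_neg, by
    obtain ⟨M, hM⟩ := hK.bdd; exact ⟨M, fun t => hM _⟩⟩
  have := (h.mul_nice hK' 0 (-a) (-b)).comp_sub_left 0
  simpa using this

/-- convolution of an integrable periodic function with a trig polynomial -/
lemma cv_trig_right {n : ℕ} {φ T : ℝ → ℝ} (h : PI φ) (hT : IsTrigPoly n T) :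
    IsTrigPoly n (cv φ T) := by
  obtain ⟨a, b, hab⟩ := hT
  have hT : IsTrigPoly n T := ⟨a, b, hab⟩
  have hc : ∀ k : ℕ, Nice (fun t => Real.cos (k * t)) := fun k =>
    ⟨by fun_prop, 1, fun t => Real.abs_cos_le_one _⟩
  have hs : ∀ k : ℕ, Nice (fun t => Real.sin (k * t)) := fun k =>
    ⟨by fun_prop, 1, fun t => Real.abs_sin_le_one _⟩
  refine ⟨fun k => a k * (∫ u in (-π)..π, φ u * Real.cos (k * u))
      - b k * (∫ u in (-π)..π, φ u * Real.sin (k * u)),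
    fun k => a k * (∫ u in (-π)..π, φ u * Real.sin (k * u))
      + b k * (∫ u in (-π)..π, φ u * Real.cos (k * u)), fun x => ?_⟩
  have e1 : cv φ T x = ∫ u in (-π)..π, φ u * T (x - u) := by
    have hp : Function.Periodic (fun u => φ u * T (x - u)) (2 * π) := by
      intro u
      simp only []
      rw [h.per, show x - (u + 2 * π) = x - u - 2 * π by ring, hT.periodic.sub_eq]
    rw [← per_refl hp x]
    unfold cv
    simp
  rw [e1]
  have e2 : ∀ u, φ u * T (x - u) = ∑ k ∈ Finset.range n,
      ((a k * Real.cos (k * x) + b k * Real.sin (k * x)) * (φ u * Real.cos (k * u)) +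
       (a k * Real.sin (k * x) - b k * Real.cos (k * x)) * (φ u * Real.sin (k * u))) := by
    intro u
    rw [hab, Finset.mul_sum]
    refine Finset.sum_congr rfl fun k _ => ?_
    rw [mul_sub, Real.cos_sub, Real.sin_sub]; ring
  simp_rw [e2]
  rw [intervalIntegral.integral_finsetSum]
  · refine Finset.sum_congr rfl fun k _ => ?_
    rw [intervalIntegral.integral_add, intervalIntegral.integral_const_mul,
      intervalIntegral.integral_const_mul]
    · ring
    · exact (h.mul_nice' (hc k) _ _).const_mul _
    · exact (h.mul_nice' (hs k) _ _).const_mul _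
  · intro k _
    exact ((h.mul_nice' (hc k) _ _).const_mul _).add ((h.mul_nice' (hs k) _ _).const_mul _)

lemma cv_trig_left {n : ℕ} {T K : ℝ → ℝ} (hT : IsTrigPoly n T) (hK : Nice K) :
    IsTrigPoly n (cv T K) := by
  obtain ⟨a, b, hab⟩ := hT
  refine ⟨fun k => a k * (∫ u in (-π)..π, Real.cos (k * u) * K u)
      - b k * (∫ u in (-π)..π, Real.sin (k * u) * K u),
    fun k => a k * (∫ u in (-π)..π, Real.sin (k * u) * K u)
      + b k * (∫ u in (-π)..π, Real.cos (k * u) * K u), fun x => ?_⟩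
  have hc : ∀ k : ℕ, Nice (fun t => Real.cos (k * t)) := fun k =>
    ⟨by fun_prop, 1, fun t => Real.abs_cos_le_one _⟩
  have hs : ∀ k : ℕ, Nice (fun t => Real.sin (k * t)) := fun k =>
    ⟨by fun_prop, 1, fun t => Real.abs_sin_le_one _⟩
  have e2 : ∀ u, T (x - u) * K u = ∑ k ∈ Finset.range n,
      ((a k * Real.cos (k * x) + b k * Real.sin (k * x)) * (Real.cos (k * u) * K u) +
       (a k * Real.sin (k * x) - b k * Real.cos (k * x)) * (Real.sin (k * u) * K u)) := by
    intro u
    rw [hab, Finset.sum_mul]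
    refine Finset.sum_congr rfl fun k _ => ?_
    rw [mul_sub, Real.cos_sub, Real.sin_sub]; ring
  unfold cv
  simp_rw [e2]
  rw [intervalIntegral.integral_finsetSum]
  · refine Finset.sum_congr rfl fun k _ => ?_
    rw [intervalIntegral.integral_add, intervalIntegral.integral_const_mul,
      intervalIntegral.integral_const_mul]
    · ring
    · exact (((hc k).mul hK).ii _ _).const_mul _
    · exact (((hs k).mul hK).ii _ _).const_mul _
  · intro k _
    exact ((((hc k).mul hK).ii _ _).const_mul _).add ((((hs k).mul hK).ii _ _).const_mul _)

lemma mod_nat {ω : ℝ → ℝ} (hω : IsModulus ω) (s : ℝ) (hs : 0 ≤ s) (k : ℕ) :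
    ω (k * s) ≤ k * ω s := by
  obtain ⟨-, -, hsub, h0, -⟩ := hω
  induction k with
  | zero => simp [h0]
  | succ k ih =>
    have := hsub (k * s) s (by positivity) hs
    push_cast
    rw [add_mul, one_mul]
    linarith

lemma mod_ratio {ω : ℝ → ℝ} (hω : IsModulus ω) {s t : ℝ} (hs : 0 < s) (ht : 0 ≤ t) :
    ω t ≤ (1 + t / s) * ω s := by
  have h1 := mod_nat hω s hs.le ⌈t / s⌉₊
  have h2 : t ≤ ⌈t / s⌉₊ * s := by
    have := Nat.le_ceil (t / s)
    rwa [div_le_iff₀ hs] at this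
  have h3 : (⌈t / s⌉₊ : ℝ) ≤ 1 + t / s := by
    have := (Nat.ceil_lt_add_one (div_nonneg ht hs.le)).le
    linarith
  have h4 := hω.2.1 (Set.mem_Ici.2 ht) (Set.mem_Ici.2 (ht.trans h2)) h2
  exact h4.trans (h1.trans (mul_le_mul_of_nonneg_right h3 (hω.2.2.2.2 s hs.le)))

/-- the class condition -/
def HL (φ ω : ℝ → ℝ) : Prop := ∀ h : ℝ, (∫ x in (-π)..π, |φ (x + h) - φ x|) ≤ ω |h|

lemma DDsq_trig {n : ℕ} (hn : 1 ≤ n) : IsTrigPoly n (fun t => DD ((n + 1) / 2) t ^ 2) := by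
  set m := (n + 1) / 2 with hm
  have e : (fun t => DD m t ^ 2) = fun t => ∑ p ∈ Finset.range m ×ˢ Finset.range m,
      ∑ q ∈ Finset.range m ×ˢ Finset.range m,
      (1 / 2) * (Real.cos ((((p.1 : ℤ) - (p.2 : ℤ)) + ((q.1 : ℤ) - (q.2 : ℤ)) : ℤ) * t + 0) +
        Real.cos ((((p.1 : ℤ) - (p.2 : ℤ)) - ((q.1 : ℤ) - (q.2 : ℤ)) : ℤ) * t + 0)) := by
    funext t
    rw [pow_two, DD_double, Finset.sum_mul_sum]
    refine Finset.sum_congr rfl fun p _ => Finset.sum_congr rfl fun q _ => ?_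
    rw [Int.cast_add, Int.cast_sub ((p.1 : ℤ) - (p.2 : ℤ)), add_zero, add_zero, add_mul, sub_mul,
      Real.cos_add, Real.cos_sub]
    ring
  rw [e]
  refine IsTrigPoly.sum _ _ fun p hp => IsTrigPoly.sum _ _ fun q hq => IsTrigPoly.smul _ ?_
  simp only [Finset.mem_product, Finset.mem_range] at hp hq
  refine IsTrigPoly.add (IsTrigPoly.cosZ ?_ _) (IsTrigPoly.cosZ ?_ _)
  · rw [abs_lt]; omega
  · rw [abs_lt]; omega

lemma DD_lower {m : ℕ} (hm : 1 ≤ m) {t : ℝ} (ht : 0 < t) (ht' : t ≤ π / m) :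
    4 * (m : ℝ) ^ 2 / π ^ 2 ≤ DD m t := by
  have hm' : (1 : ℝ) ≤ m := by exact_mod_cast hm
  have hmt : m * t ≤ π := by
    rw [le_div_iff₀ (by positivity)] at ht'
    linarith
  have h1 := Real.mul_le_sin (x := m * t / 2) (by positivity) (by linarith)
  have h2 := Real.sin_le (x := t / 2) (by positivity)
  have htpi : t ≤ π := by nlinarith
  have h3 : 0 ≤ Real.sin (t / 2) := Real.sin_nonneg_of_nonneg_of_le_pi (by linarith) (by linarith)
  have h4 := DD_sin m t
  have h5 : (2 / π * (m * t / 2)) ^ 2 ≤ DD m t * (t / 2) ^ 2 := by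
    calc (2 / π * (m * t / 2)) ^ 2 ≤ Real.sin (m * t / 2) ^ 2 := by
          apply pow_le_pow_left₀ (by positivity) h1
      _ = DD m t * Real.sin (t / 2) ^ 2 := h4.symm
      _ ≤ _ := mul_le_mul_of_nonneg_left (pow_le_pow_left₀ h3 h2 2) (DD_nonneg _ _)
  have h6 : (2 / π * (m * t / 2)) ^ 2 = (4 * (m : ℝ) ^ 2 / π ^ 2) * (t / 2) ^ 2 := by
    field_simp; ring
  rw [h6] at h5
  exact le_of_mul_le_mul_right h5 (by positivity)

lemma DDsq_int_lower {m : ℕ} (hm : 1 ≤ m) :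
    16 * (m : ℝ) ^ 3 / π ^ 3 ≤ ∫ t in (-π)..π, DD m t ^ 2 := by
  have hm' : (1 : ℝ) ≤ m := by exact_mod_cast hm
  have hpm : π / m ≤ π := div_le_self pi_pos.le hm'
  have hc : Continuous (fun t => DD m t ^ 2) := (DD_cont m).pow 2
  have h1 : ∫ t in (0)..(π / m), DD m t ^ 2 ≤ ∫ t in (-π)..π, DD m t ^ 2 := by
    refine intervalIntegral.integral_mono_interval (by linarith [pi_pos]) (by positivity) hpm
      (Eventually.of_forall fun t => by positivity) (hc.intervalIntegrable _ _)
  refine le_trans ?_ h1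
  have h2 : ∫ t in (0)..(π / m), (4 * (m : ℝ) ^ 2 / π ^ 2) ^ 2 ≤ ∫ t in (0)..(π / m), DD m t ^ 2 := by
    refine intervalIntegral.integral_mono_on_of_le_Ioo (by positivity) (by simp)
      (hc.intervalIntegrable _ _) fun t ht => ?_
    exact pow_le_pow_left₀ (by positivity) (DD_lower hm ht.1 ht.2.le) 2
  refine le_trans (le_of_eq ?_) h2
  rw [intervalIntegral.integral_const]
  simp only [smul_eq_mul]
  field_simp
  ring

lemma DDsq_moment (m : ℕ) :
    ∫ t in (-π)..π, t ^ 2 * DD m t ^ 2 ≤ 2 * π ^ 3 * m := by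
  have hc : Continuous (fun t => t ^ 2 * DD m t ^ 2) := by
    have := DD_cont m
    fun_prop
  have h1 : ∫ t in (-π)..π, t ^ 2 * DD m t ^ 2 ≤ ∫ t in (-π)..π, π ^ 2 * DD m t := by
    refine intervalIntegral.integral_mono_on negpi_le (hc.intervalIntegrable _ _)
      (((DD_cont m).const_mul _).intervalIntegrable _ _) fun t ht => ?_
    have key : t ^ 2 ≤ π ^ 2 * Real.sin (t / 2) ^ 2 := by
      have h0 : |t| ≤ π := abs_le.2 ⟨ht.1, ht.2⟩
      have := Real.mul_le_sin (x := |t| / 2) (by positivity) (by linarith)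
      have h2 : Real.sin (|t| / 2) ^ 2 = Real.sin (t / 2) ^ 2 := by
        rcases abs_choice t with h | h <;> rw [h]
        rw [neg_div, Real.sin_neg]; ring
      rw [← h2, ← mul_pow, ← sq_abs]
      apply pow_le_pow_left₀ (abs_nonneg _)
      have h3 : 2 / π * (|t| / 2) = |t| / π := by field_simp
      rw [h3, div_le_iff₀ pi_pos] at this
      linarith
    have h4 := DD_sin m t
    have h5 := DD_nonneg m t
    calc t ^ 2 * DD m t ^ 2 ≤ (π ^ 2 * Real.sin (t / 2) ^ 2) * DD m t ^ 2 :=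
          mul_le_mul_of_nonneg_right key (by positivity)
      _ = π ^ 2 * DD m t * (DD m t * Real.sin (t / 2) ^ 2) := by ring
      _ = π ^ 2 * DD m t * Real.sin (m * t / 2) ^ 2 := by rw [h4]
      _ ≤ π ^ 2 * DD m t := mul_le_of_le_one_right (by positivity) (Real.sin_sq_le_one _)
  refine h1.trans (le_of_eq ?_)
  rw [intervalIntegral.integral_const_mul, DD_integral]; ring

def CJ : ℝ := 2 + π ^ 6 / 2

lemma CJ_pos : 0 < CJ := by unfold CJ; positivity

lemma jackson {φ ω : ℝ → ℝ} (h : PI φ) (hω : IsModulus ω) (hφ : HL φ ω) {n : ℕ} (hn : 1 ≤ n) :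
    ∃ T, IsTrigPoly n T ∧ ∫ x in (-π)..π, |φ x - T x| ≤ CJ * ω (1 / n) := by
  set m := (n + 1) / 2 with hm
  have hm1 : 1 ≤ m := by omega
  have hnm : n ≤ 2 * m := by omega
  have hJ : IsTrigPoly n (fun t => DD m t ^ 2) := DDsq_trig hn
  set J := fun t => DD m t ^ 2 with hJdef
  have hJn : Nice J := Nice.of_trig hJ
  have hJc : Continuous J := hJ.continuous
  have hJ0 : ∀ t, 0 ≤ J t := fun t => by simp only [hJdef]; positivity
  set I := ∫ t in (-π)..π, J t with hI
  have hIl : 16 * (m : ℝ) ^ 3 / π ^ 3 ≤ I := DDsq_int_lower hm1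
  have hm1' : (1 : ℝ) ≤ m := by exact_mod_cast hm1
  have hIpos : 0 < I := lt_of_lt_of_le (by positivity) hIl
  have hnR : (1 : ℝ) ≤ n := by exact_mod_cast hn
  refine ⟨fun x => (1 / I) * cv φ J x, (cv_trig_right h hJ).smul _, ?_⟩
  set H : ℝ → ℝ → ℝ := fun x t => φ x * J t - φ (x - t) * J t with hH
  have hHi : Integrable (fun p : ℝ × ℝ => H p.1 p.2)
      ((volume.restrict (Set.Ioc (-π) π)).prod (volume.restrict (Set.Ioc (-π) π))) := by
    have h1 := prodInt h (a := -π) (b := π) 0 0 hJn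
    have h2 := h1.sub (cv_prod h hJn)
    refine h2.congr (Eventually.of_forall fun p => ?_)
    simp [hH]
  have e : ∀ x, φ x - (1 / I) * cv φ J x = (1 / I) * ∫ t in (-π)..π, H x t := by
    intro x
    simp only [hH]
    rw [intervalIntegral.integral_sub ((hJc.const_mul _).intervalIntegrable _ _)
      (h.mul_nice hJn x _ _), intervalIntegral.integral_const_mul]
    unfold cv
    rw [← hI]
    field_simp
  simp_rw [e, abs_mul, abs_of_pos (one_div_pos.2 hIpos)]
  rw [intervalIntegral.integral_const_mul]
  have hω1 : 0 ≤ ω (1 / n) := hω.2.2.2.2 _ (by positivity)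
  have hb : ∫ t in (-π)..π, ∫ x in (-π)..π, |H x t| ≤
      ∫ t in (-π)..π, (ω (1 / n) * (2 * J t + (n : ℝ) ^ 2 * (t ^ 2 * J t))) := by
    refine intervalIntegral.integral_mono_on negpi_le ?_ ?_ fun t _ => ?_
    · have := hHi.norm.swap.integral_prod_left
      rw [intervalIntegrable_iff_integrableOn_Ioc_of_le negpi_le]
      simp only [intervalIntegral.integral_of_le negpi_le]
      exact this
    · exact (by fun_prop : Continuous fun t => (ω (1 / n) * (2 * J t + (n : ℝ) ^ 2 * (t ^ 2 * J t)))).intervalIntegrable _ _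
    · have e3 : ∫ x in (-π)..π, |H x t| = (∫ x in (-π)..π, |φ (x + -t) - φ x|) * J t := by
        rw [← intervalIntegral.integral_mul_const]
        refine intervalIntegral.integral_congr fun x _ => ?_
        simp only [hH]
        rw [← sub_mul, abs_mul, abs_of_nonneg (hJ0 t), abs_sub_comm, sub_eq_add_neg x t]
      rw [e3]
      have h1 := hφ (-t)
      have h2 := mod_ratio hω (s := 1 / n) (t := |-t|) (by positivity) (abs_nonneg _)
      have h3 : 1 + |-t| / (1 / (n : ℝ)) ≤ 2 + (n : ℝ) ^ 2 * t ^ 2 := by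
        rw [abs_neg, div_div_eq_mul_div, div_one, ← sq_abs t]
        nlinarith [sq_nonneg (|t| * n - 1), abs_nonneg t]
      have h4 : ∫ x in (-π)..π, |φ (x + -t) - φ x| ≤ (2 + (n : ℝ) ^ 2 * t ^ 2) * ω (1 / n) :=
        h1.trans (h2.trans (mul_le_mul_of_nonneg_right h3 hω1))
      calc _ ≤ ((2 + (n : ℝ) ^ 2 * t ^ 2) * ω (1 / n)) * J t :=
            mul_le_mul_of_nonneg_right h4 (hJ0 t)
        _ = _ := by ring
  have hb2 : ∫ t in (-π)..π, (ω (1 / n) * (2 * J t + (n : ℝ) ^ 2 * (t ^ 2 * J t))) ≤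
      ω (1 / n) * (2 * I + (n : ℝ) ^ 2 * (2 * π ^ 3 * m)) := by
    rw [intervalIntegral.integral_const_mul, intervalIntegral.integral_add,
      intervalIntegral.integral_const_mul, intervalIntegral.integral_const_mul]
    · exact mul_le_mul_of_nonneg_left (add_le_add le_rfl
        (mul_le_mul_of_nonneg_left (DDsq_moment m) (by positivity))) hω1
    · exact (hJc.const_mul _).intervalIntegrable _ _
    · exact (by fun_prop : Continuous fun t => (n : ℝ) ^ 2 * (t ^ 2 * J t)).intervalIntegrable _ _
  have hmk := ((mink negpi_le hHi).trans hb).trans hb2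
  have hfin : (n : ℝ) ^ 2 * (2 * π ^ 3 * m) ≤ (π ^ 6 / 2) * I := by
    have hnm' : (n : ℝ) ≤ 2 * m := by exact_mod_cast hnm
    calc (n : ℝ) ^ 2 * (2 * π ^ 3 * m) ≤ (2 * (m : ℝ)) ^ 2 * (2 * π ^ 3 * m) := by gcongr
      _ = (π ^ 6 / 2) * (16 * (m : ℝ) ^ 3 / π ^ 3) := by field_simp; ring
      _ ≤ _ := by gcongr
  calc 1 / I * ∫ x in (-π)..π, |∫ t in (-π)..π, H x t|
      ≤ 1 / I * (ω (1 / n) * (2 * I + (n : ℝ) ^ 2 * (2 * π ^ 3 * m))) := by gcongr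
    _ ≤ 1 / I * (ω (1 / n) * (2 * I + (π ^ 6 / 2) * I)) := by gcongr
    _ = CJ * ω (1 / n) := by unfold CJ; field_simp

/-- kernel `K` convolved with `φ` approximated within `b` -/
def Good (n : ℕ) (φ K : ℝ → ℝ) (b : ℝ) : Prop :=
  ∃ T, IsTrigPoly n T ∧ ∫ x in (-π)..π, |cv φ K x - T x| ≤ b

lemma Good.add {n : ℕ} {φ K L : ℝ → ℝ} {b c : ℝ} (h : PI φ) (hK : Nice K) (hL : Nice L)
    (gK : Good n φ K b) (gL : Good n φ L c) : Good n φ (fun t => K t + L t) (b + c) := by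
  obtain ⟨S, hS, hb⟩ := gK
  obtain ⟨T, hT, hc⟩ := gL
  refine ⟨_, hS.add hT, ?_⟩
  have i1 := (((cv_PI h hK).sub (PI.of_trig hS)).ii).abs
  have i2 := (((cv_PI h hL).sub (PI.of_trig hT)).ii).abs
  refine le_trans ?_ (add_le_add hb hc)
  rw [← intervalIntegral.integral_add i1 i2]
  refine intervalIntegral.integral_mono_on negpi_le ?_ (i1.add i2) fun x _ => ?_
  · exact (((cv_PI h (hK.add hL)).sub (PI.of_trig (hS.add hT))).ii).abs
  · rw [cv_add h hK hL]
    refine le_trans (le_of_eq ?_) (abs_add_le _ _)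
    congr 1; ring

lemma Good.smul {n : ℕ} {φ K : ℝ → ℝ} {b : ℝ} (c : ℝ) 
    (gK : Good n φ K b) : Good n φ (fun t => c * K t) (|c| * b) := by
  obtain ⟨S, hS, hb⟩ := gK
  refine ⟨_, hS.smul c, ?_⟩
  simp_rw [cv_smul, ← mul_sub, abs_mul]
  rw [intervalIntegral.integral_const_mul]
  exact mul_le_mul_of_nonneg_left hb (abs_nonneg _)

lemma Good.mono {n : ℕ} {φ K : ℝ → ℝ} {b c : ℝ} (g : Good n φ K b) (hbc : b ≤ c) :
    Good n φ K c := by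
  obtain ⟨S, hS, hb⟩ := g
  exact ⟨S, hS, hb.trans hbc⟩

lemma Good.trig {n : ℕ} {φ T : ℝ → ℝ} (h : PI φ) (hT : IsTrigPoly n T) : Good n φ T 0 :=
  ⟨cv φ T, cv_trig_right h hT, by simp⟩

lemma Good.of_norm {n : ℕ} {φ K : ℝ → ℝ} {b : ℝ} (hb : ∫ x in (-π)..π, |cv φ K x| ≤ b) :
    Good n φ K b := ⟨_, IsTrigPoly.zero, by simpa using hb⟩

lemma Good.sum {n : ℕ} {φ : ℝ → ℝ} (h : PI φ) {ι : Type*} (s : Finset ι) (F : ι → ℝ → ℝ)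
    (b : ι → ℝ) (hN : ∀ i ∈ s, Nice (F i)) (hF : ∀ i ∈ s, Good n φ (F i) (b i)) :
    Good n φ (fun t => ∑ i ∈ s, F i t) (∑ i ∈ s, b i) := by
  classical
  induction s using Finset.induction_on with
  | empty => simpa using Good.trig h IsTrigPoly.zero
  | insert i s hi ih =>
    have h1 := Good.add h (hN i (Finset.mem_insert_self _ _))
      (Nice.sum s F fun j hj => hN j (Finset.mem_insert_of_mem hj))
      (hF i (Finset.mem_insert_self _ _))
      (ih (fun j hj => hN j (Finset.mem_insert_of_mem hj))
        fun j hj => hF j (Finset.mem_insert_of_mem hj))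
    simpa [Finset.sum_insert hi] using h1

lemma Good.jackson {φ ω : ℝ → ℝ} (h : PI φ) (hω : IsModulus ω) (hφ : HL φ ω) {n : ℕ} (hn : 1 ≤ n)
    {K : ℝ → ℝ} (hK : Nice K) {b : ℝ} (hb : ∫ t in (-π)..π, |K t| ≤ b) :
    Good n φ K (CJ * ω (1 / n) * b) := by
  obtain ⟨T, hT, hTb⟩ := _root_.jackson h hω hφ hn
  refine ⟨cv T K, cv_trig_left hT hK, ?_⟩
  have hs := h.sub (PI.of_trig hT)
  have := cv_norm hs hK
  simp_rw [cv_sub_left h (PI.of_trig hT) hK] at this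
  have hω1 : 0 ≤ ω (1 / n) := hω.2.2.2.2 _ (by positivity)
  refine this.trans (mul_le_mul hTb hb ?_ (mul_nonneg CJ_pos.le hω1))
  exact intervalIntegral.integral_nonneg negpi_le fun t _ => abs_nonneg _

/-- cell end points -/
def ce (n : ℕ) (θ : ℝ) (j : ℕ) : ℝ := (θ + π * j) / n

/-- rounding to the cell centre -/
def rr (n : ℕ) (θ t : ℝ) : ℝ := (θ + π / 2 + π * ⌊(n * t - θ) / π⌋) / n

lemma ce_le (n : ℕ) (θ : ℝ) (j : ℕ) : ce n θ j ≤ ce n θ (j + 1) := by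
  unfold ce
  have := pi_pos
  push_cast
  gcongr
  linarith

lemma cell_sum {n : ℕ} (hn : 1 ≤ n) (θ : ℝ) {F : ℝ → ℝ} (hF : Function.Periodic F (2 * π))
    (hi : ∀ a b, IntervalIntegrable F volume a b) :
    ∫ t in (-π)..π, F t = ∑ j ∈ Finset.range (2 * n), ∫ t in (ce n θ j)..(ce n θ (j + 1)), F t := by
  rw [intervalIntegral.sum_integral_adjacent_intervals (fun k _ => hi _ _), per_shift' hF (ce n θ 0)]
  congr 1
  have : (n : ℝ) ≠ 0 := by positivity
  unfold ce
  push_cast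
  field_simp
  ring

lemma rr_cell {n : ℕ} (hn : 1 ≤ n) (θ : ℝ) (j : ℕ) {t : ℝ} (h1 : ce n θ j ≤ t)
    (h2 : t < ce n θ (j + 1)) : rr n θ t = (θ + π / 2 + π * j) / n := by
  have hn' : (0 : ℝ) < n := by positivity
  unfold ce at h1 h2
  rw [div_le_iff₀ hn'] at h1
  rw [lt_div_iff₀ hn'] at h2
  have : ⌊(n * t - θ) / π⌋ = (j : ℤ) := by
    rw [Int.floor_eq_iff]
    constructor
    · rw [le_div_iff₀ pi_pos]; push_cast; linarith
    · rw [div_lt_iff₀ pi_pos]; push_cast at h2 ⊢; linarith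
  unfold rr
  rw [this]; push_cast; rfl

lemma rr_per {n : ℕ} (hn : 1 ≤ n) (θ t : ℝ) : rr n θ (t + 2 * π) = rr n θ t + 2 * π := by
  have hn' : (n : ℝ) ≠ 0 := by positivity
  unfold rr
  have : (n * (t + 2 * π) - θ) / π = (n * t - θ) / π + ((2 * n : ℕ) : ℤ) := by
    push_cast; field_simp; ring
  rw [this, Int.floor_add_intCast]
  push_cast; field_simp; ring

lemma rr_meas (n : ℕ) (θ : ℝ) : Measurable (rr n θ) := by
  unfold rr
  fun_prop

lemma eN_eq {n : ℕ} (hn : 1 ≤ n) (ω : ℝ → ℝ) :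
    ∫ u in (0:ℝ)..(π / (2 * n)), ω (2 * u) * Real.sin (n * u) = eN n ω / n := by
  have hn' : (n : ℝ) ≠ 0 := by positivity
  have := intervalIntegral.integral_comp_mul_left (a := 0) (b := π / (2 * n))
    (fun t => ω (2 * t / n) * Real.sin t) hn'
  simp only [smul_eq_mul] at this
  unfold eN
  rw [show (n : ℝ) * 0 = 0 by ring, show (n : ℝ) * (π / (2 * n)) = π / 2 by field_simp] at this
  refine Eq.trans ?_ (this.trans (inv_mul_eq_div _ _))
  refine intervalIntegral.integral_congr fun u _ => ?_
  beta_reduce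
  congr 2
  field_simp

lemma ω_cont_ii {ω : ℝ → ℝ} (hω : IsModulus ω) (c : ℝ) (hc : 0 ≤ c) {a b : ℝ} (ha : 0 ≤ a) (hb : 0 ≤ b) {k : ℝ → ℝ}
    (hk : Continuous k) : IntervalIntegrable (fun u => ω (c * u) * k u) volume a b := by
  apply ContinuousOn.intervalIntegrable
  have : ContinuousOn (fun u => ω (c * u)) (Set.uIcc a b) := by
    refine hω.1.comp (by fun_prop) fun u hu => ?_
    have : 0 ≤ u := le_trans (le_min ha hb) hu.1
    exact mul_nonneg hc this
  exact this.mul hk.continuousOn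

lemma half_cell {φ ω : ℝ → ℝ} (h : PI φ) (hω : IsModulus ω) (hφ : HL φ ω) {n : ℕ} (hn : 1 ≤ n)
    (b : ℝ) :
    ∫ x in (-π)..π, |∫ u in (-(π / (2 * n)))..(π / (2 * n)), φ (x - (b + u)) * Real.sin (n * u)|
      ≤ eN n ω / n := by
  have hn' : (0 : ℝ) < n := by positivity
  set δ := π / (2 * n) with hδ
  have hδ0 : 0 ≤ δ := by positivity
  have hnd : n * δ = π / 2 := by rw [hδ]; field_simp
  have hsN : Nice (fun u : ℝ => Real.sin (n * u)) := ⟨by fun_prop, 1, fun t => abs_sin_le_one _⟩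
  have hii : ∀ x a' b', IntervalIntegrable (fun u => φ (x - (b + u)) * Real.sin (n * u)) volume a' b' := by
    intro x a' b'
    have := h.mul_nice hsN (x - b) a' b'
    refine this.congr ?_
    exact fun u _ => by simp only [sub_sub]
  have e : ∀ x, ∫ u in (-δ)..δ, φ (x - (b + u)) * Real.sin (n * u)
      = ∫ u in (0:ℝ)..δ, (φ (x - (b + u)) - φ (x - (b - u))) * Real.sin (n * u) := by
    intro x
    rw [← intervalIntegral.integral_add_adjacent_intervals (hii x (-δ) 0) (hii x 0 δ)]
    have e1 : ∫ u in (-δ)..0, φ (x - (b + u)) * Real.sin (n * u)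
        = ∫ u in (0:ℝ)..δ, - (φ (x - (b - u)) * Real.sin (n * u)) := by
      have := intervalIntegral.integral_comp_neg (a := 0) (b := δ)
        (fun u => φ (x - (b + u)) * Real.sin (n * u))
      rw [neg_zero] at this
      rw [← this]
      refine intervalIntegral.integral_congr fun u _ => ?_
      simp only [mul_neg, Real.sin_neg, sub_eq_add_neg]
    have i2 : IntervalIntegrable (fun u => - (φ (x - (b - u)) * Real.sin (n * u))) volume 0 δ := by
      have := (hii x (0) (-δ)).comp_sub_left 0
      simp only [zero_sub, neg_neg, neg_zero] at this
      refine this.congr ?_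
      refine fun u _ => ?_
      simp only [mul_neg, Real.sin_neg, sub_eq_add_neg]
    rw [e1, ← intervalIntegral.integral_add i2 (hii x 0 δ)]
    refine intervalIntegral.integral_congr fun u _ => ?_
    beta_reduce; ring
  simp_rw [e]
  have hp : Integrable (fun p : ℝ × ℝ => (φ (p.1 - (b + p.2)) - φ (p.1 - (b - p.2))) * Real.sin (n * p.2))
      ((volume.restrict (Set.Ioc (-π) π)).prod (volume.restrict (Set.Ioc 0 δ))) := by
    have h1 := prodInt h (a := 0) (b := δ) (-1) (-b) hsN
    have h2 := prodInt h (a := 0) (b := δ) 1 (-b) hsN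
    refine (h1.sub h2).congr (Filter.Eventually.of_forall fun p => ?_)
    simp only [Pi.sub_apply]
    rw [show p.1 + -1 * p.2 + -b = p.1 - (b + p.2) by ring,
      show p.1 + 1 * p.2 + -b = p.1 - (b - p.2) by ring]
    ring
  refine (mink (H := fun x u => (φ (x - (b + u)) - φ (x - (b - u))) * Real.sin (n * u)) hδ0 hp).trans ?_
  rw [← eN_eq hn ω]
  have hin : ∀ u, ∫ x in (-π)..π, |(φ (x - (b + u)) - φ (x - (b - u))) * Real.sin (n * u)|
      = (∫ x in (-π)..π, |φ (x + 2 * u) - φ x|) * |Real.sin (n * u)| := by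
    intro u
    simp_rw [abs_mul]
    rw [intervalIntegral.integral_mul_const]
    congr 1
    have := per_shift ((h.shift (2 * u)).sub h).abs_per (-(b + u))
    rw [← this]
    refine intervalIntegral.integral_congr fun x _ => ?_
    beta_reduce
    rw [abs_sub_comm]
    congr 3 <;> ring
  have hii1 : IntervalIntegrable (fun u => ∫ x in (-π)..π, |(φ (x - (b + u)) - φ (x - (b - u))) * Real.sin (n * u)|) volume 0 δ := by
    rw [intervalIntegrable_iff_integrableOn_Ioc_of_le hδ0]
    simp only [intervalIntegral.integral_of_le negpi_le]
    exact hp.abs.integral_prod_right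
  refine intervalIntegral.integral_mono_on hδ0 hii1 (ω_cont_ii hω 2 (by norm_num) le_rfl hδ0 (by fun_prop)) fun u hu => ?_
  have hs : 0 ≤ Real.sin (n * u) := by
    apply Real.sin_nonneg_of_nonneg_of_le_pi
    · exact mul_nonneg hn'.le hu.1
    · have := mul_le_mul_of_nonneg_left hu.2 hn'.le
      linarith [pi_pos]
  rw [hin, abs_of_nonneg hs]
  have := hφ (2 * u)
  rw [abs_of_nonneg (by linarith [hu.1] : (0:ℝ) ≤ 2 * u)] at this
  gcongr

lemma eN_nonneg {ω : ℝ → ℝ} (hω : IsModulus ω) (n : ℕ) : 0 ≤ eN n ω := by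
  unfold eN
  refine intervalIntegral.integral_nonneg (by positivity) fun t ht => ?_
  have h0 : 0 ≤ t := ht.1
  exact mul_nonneg (hω.2.2.2.2 _ (by positivity))
    (Real.sin_nonneg_of_nonneg_of_le_pi ht.1 (by linarith [ht.2, pi_pos]))

lemma eN_le {ω : ℝ → ℝ} (hω : IsModulus ω) {n : ℕ} (hn : 1 ≤ n) : eN n ω ≤ (1 + π) * ω (1 / n) := by
  have hn' : (0 : ℝ) < n := by positivity
  have h1 : ∫ t in (0:ℝ)..(π/2), Real.sin t = 1 := by simp
  have h2 : eN n ω ≤ ∫ t in (0:ℝ)..(π / 2), (1 + π) * ω (1 / n) * Real.sin t := by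
    unfold eN
    refine intervalIntegral.integral_mono_on (by positivity) ?_ (by
      apply Continuous.intervalIntegrable; fun_prop) fun t ht => ?_
    · have := ω_cont_ii hω (2 / n) (by positivity) (le_refl (0:ℝ)) (by positivity : (0:ℝ) ≤ π / 2) continuous_sin
      refine this.congr (fun u _ => ?_)
      beta_reduce
      rw [div_mul_eq_mul_div]
    · have h0 : 0 ≤ t := ht.1
      have hs : 0 ≤ Real.sin t := Real.sin_nonneg_of_nonneg_of_le_pi ht.1 (by linarith [ht.2, pi_pos])
      refine mul_le_mul_of_nonneg_right ?_ hs
      refine (mod_ratio hω (s := 1 / n) (by positivity) (by positivity)).trans ?_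
      refine mul_le_mul_of_nonneg_right ?_ (hω.2.2.2.2 _ (by positivity))
      have : 2 * t / n / (1 / n) = 2 * t := by field_simp
      rw [this]; linarith [ht.2]
  rw [intervalIntegral.integral_const_mul, h1, mul_one] at h2
  exact h2

/-- step kernel bound -/
lemma step_norm {φ ω : ℝ → ℝ} (h : PI φ) (hω : IsModulus ω) (hφ : HL φ ω) {n : ℕ} (hn : 1 ≤ n)
    (θ : ℝ) {g : ℝ → ℝ} (hg : Nice g) (hgp : Function.Periodic g (2 * π)) (hg0 : ∀ t, 0 ≤ g t) :
    ∫ x in (-π)..π, |cv φ (fun t => Real.cos (n * t - θ) * g (rr n θ t)) x|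
      ≤ eN n ω / π * ∫ t in (-π)..π, g (rr n θ t) := by
  have hn' : (0 : ℝ) < n := by positivity
  set δ := π / (2 * n) with hδ
  have hgr : Nice (fun t => g (rr n θ t)) := ⟨hg.meas.comp (rr_meas n θ), by
    obtain ⟨M, hM⟩ := hg.bdd; exact ⟨M, fun t => hM _⟩⟩
  have hgrp : Function.Periodic (fun t => g (rr n θ t)) (2 * π) := fun t => by
    simp only [rr_per hn, hgp _]
  have hK : Nice (fun t => Real.cos (n * t - θ) * g (rr n θ t)) := (Nice.cos n θ).mul hgr
  let c : ℕ → ℝ := fun j => (θ + π / 2 + π * j) / n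
  have hce : ∀ j, ce n θ j = c j - δ := fun j => by
    simp only [ce, c, hδ]; field_simp; ring
  have hce' : ∀ j, ce n θ (j + 1) = c j + δ := fun j => by
    simp only [ce, c, hδ]; push_cast; field_simp; ring
  -- integral of step
  have hint : ∫ t in (-π)..π, g (rr n θ t) = ∑ j ∈ Finset.range (2 * n), π / n * g (c j) := by
    rw [cell_sum hn θ hgrp (fun a b => hgr.ii a b)]
    refine Finset.sum_congr rfl fun j _ => ?_
    rw [intervalIntegral.integral_congr_Ioo_of_le (g := fun _ => g (c j)) (ce_le n θ j) fun t ht => by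
      simp only [rr_cell hn θ j ht.1.le ht.2]; rfl]
    rw [intervalIntegral.integral_const, hce', hce, smul_eq_mul]
    congr 1; rw [hδ]; field_simp; ring
  let A : ℕ → ℝ → ℝ := fun j x => ∫ u in (-δ)..δ, φ (x - (c j + u)) * Real.sin (n * u)
  have hcv : ∀ x, cv φ (fun t => Real.cos (n * t - θ) * g (rr n θ t)) x
      = ∑ j ∈ Finset.range (2 * n), (-(-1) ^ j * g (c j)) * A j x := by
    intro x
    unfold cv
    rw [cell_sum hn θ (fun t => ?_) (fun a b => h.mul_nice hK x a b)]
    · refine Finset.sum_congr rfl fun j _ => ?_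
      rw [intervalIntegral.integral_congr_Ioo_of_le
        (g := fun t => φ (x - t) * (Real.cos (n * t - θ) * g (c j))) (ce_le n θ j) fun t ht => by
          simp only [rr_cell hn θ j ht.1.le ht.2]; rfl]
      have := intervalIntegral.integral_comp_add_left (a := -δ) (b := δ)
        (fun t => φ (x - t) * (Real.cos (n * t - θ) * g (c j))) (c j)
      rw [hce', hce, show c j - δ = c j + -δ by ring, ← this]
      simp only [A]
      rw [← intervalIntegral.integral_const_mul]
      refine intervalIntegral.integral_congr fun u _ => ?_
      beta_reduce
      have : Real.cos (n * (c j + u) - θ) = -(-1) ^ j * Real.sin (n * u) := by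
        have : n * (c j + u) - θ = (n * u + π / 2) + j * π := by
          simp only [c]; field_simp; ring
        rw [this, Real.cos_add_nat_mul_pi, Real.cos_add_pi_div_two]; ring
      rw [this]; ring
    · beta_reduce
      rw [show x - (t + 2 * π) = x - t - 2 * π by ring, h.per.sub_eq, rr_per hn, hgp]
      congr 2
      rw [show n * (t + 2 * π) - θ = n * t - θ + n * (2 * π) by ring, Real.cos_add_nat_mul_two_pi]
  have hAii : ∀ j, IntervalIntegrable (A j) volume (-π) π := by
    intro j
    have hsN : Nice (fun u : ℝ => Real.sin (n * u)) := ⟨by fun_prop, 1, fun t => abs_sin_le_one _⟩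
    have h1 := prodInt h (a := -δ) (b := δ) (-1) (-(c j)) hsN
    have hδ0 : -δ ≤ δ := by have : 0 ≤ δ := by positivity
                            linarith
    have := mink_ii (H := fun x u => φ (x + -1 * u + -(c j)) * Real.sin (n * u)) hδ0 h1
    refine this.congr fun x _ => ?_
    simp only [A]
    refine intervalIntegral.integral_congr fun u _ => ?_
    beta_reduce
    congr 2; ring
  simp_rw [hcv]
  calc ∫ x in (-π)..π, |∑ j ∈ Finset.range (2 * n), (-(-1) ^ j * g (c j)) * A j x|
      ≤ ∫ x in (-π)..π, ∑ j ∈ Finset.range (2 * n), g (c j) * |A j x| := by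
        refine intervalIntegral.integral_mono_on negpi_le ?_ ?_ fun x _ => ?_
        · refine IntervalIntegrable.abs ?_
          have := IntervalIntegrable.sum (μ := volume) (a := -π) (b := π) (Finset.range (2 * n)) (f := fun j x => (-(-1) ^ j * g (c j)) * A j x)
            fun j _ => (hAii j).const_mul _
          refine this.congr (fun x _ => by simp [Finset.sum_apply])
        · have := IntervalIntegrable.sum (μ := volume) (a := -π) (b := π) (Finset.range (2 * n)) (f := fun j x => g (c j) * |A j x|)
            fun j _ => (hAii j).abs.const_mul _
          refine this.congr (fun x _ => by simp [Finset.sum_apply])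
        · refine (Finset.abs_sum_le_sum_abs _ _).trans (Finset.sum_le_sum fun j _ => le_of_eq ?_)
          rw [abs_mul, abs_mul, abs_of_nonneg (hg0 _), abs_neg, abs_pow, abs_neg, abs_one, one_pow, one_mul]
    _ = ∑ j ∈ Finset.range (2 * n), g (c j) * ∫ x in (-π)..π, |A j x| := by
        rw [intervalIntegral.integral_finsetSum fun j _ => (hAii j).abs.const_mul _]
        simp_rw [intervalIntegral.integral_const_mul]
    _ ≤ ∑ j ∈ Finset.range (2 * n), g (c j) * (eN n ω / n) :=
        Finset.sum_le_sum fun j _ => mul_le_mul_of_nonneg_left (half_cell h hω hφ hn (c j)) (hg0 _)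
    _ = _ := by
        rw [hint, Finset.mul_sum]
        refine Finset.sum_congr rfl fun j _ => ?_
        have := pi_pos.ne'
        field_simp

lemma wsum_double (a : ℕ → ℝ) (w : ℕ) (t : ℝ) :
    (∑ j ∈ Finset.range w, a j * Real.cos (j * t)) ^ 2
      + (∑ j ∈ Finset.range w, a j * Real.sin (j * t)) ^ 2
    = ∑ p ∈ Finset.range w ×ˢ Finset.range w,
      a p.1 * a p.2 * Real.cos (((p.1 : ℤ) - (p.2 : ℤ) : ℤ) * t + 0) := by
  rw [pow_two, pow_two, Finset.sum_mul_sum, Finset.sum_mul_sum, Finset.sum_product,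
    ← Finset.sum_add_distrib]
  refine Finset.sum_congr rfl fun i _ => ?_
  rw [← Finset.sum_add_distrib]
  refine Finset.sum_congr rfl fun j _ => ?_
  push_cast
  rw [add_zero, sub_mul, Real.cos_sub]; ring

lemma wsum_int (a : ℕ → ℝ) (w : ℕ) :
    ∫ t in (-π)..π, ((∑ j ∈ Finset.range w, a j * Real.cos (j * t)) ^ 2
      + (∑ j ∈ Finset.range w, a j * Real.sin (j * t)) ^ 2) = 2 * π * ∑ j ∈ Finset.range w, a j ^ 2 := by
  simp_rw [wsum_double]
  rw [intervalIntegral.integral_finsetSum]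
  · rw [Finset.sum_product, Finset.mul_sum]
    refine Finset.sum_congr rfl fun i hi => ?_
    rw [Finset.sum_eq_single i]
    · simp; ring
    · intro j _ hj
      simp only []
      rw [intervalIntegral.integral_const_mul, int_cos_int _ (by omega), mul_zero]
    · intro h; exact absurd hi h
  · intro p _
    apply Continuous.intervalIntegrable; fun_prop

/-- majorant of the derivative of `DD` -/
def GG (w : ℕ) (t : ℝ) : ℝ :=
  1 / w * ((∑ j ∈ Finset.range w, (j : ℝ) * Real.cos (j * t)) ^ 2
      + (∑ j ∈ Finset.range w, (j : ℝ) * Real.sin (j * t)) ^ 2)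
  + w * DD w t

lemma GG_cont (w : ℕ) : Continuous (GG w) := by
  have := DD_cont w
  unfold GG; fun_prop

lemma GG_nonneg (w : ℕ) (t : ℝ) : 0 ≤ GG w t := by
  have := DD_nonneg w t
  unfold GG; positivity

lemma GG_per (w : ℕ) : Function.Periodic (GG w) (2 * π) := by
  intro x
  unfold GG
  have e : ∀ k : ℕ, (k : ℝ) * (x + 2 * π) = k * x + k * (2 * π) := fun k => by ring
  simp_rw [DD_periodic w x, e, Real.cos_add_nat_mul_two_pi, Real.sin_add_nat_mul_two_pi]

lemma GG_int {w : ℕ} (hw : 1 ≤ w) : ∫ t in (-π)..π, GG w t ≤ 4 * π * (w : ℝ) ^ 2 := by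
  have hw' : (0 : ℝ) < w := by positivity
  unfold GG
  have := DD_cont w
  rw [intervalIntegral.integral_add (by apply Continuous.intervalIntegrable; fun_prop)
    (by apply Continuous.intervalIntegrable; fun_prop), intervalIntegral.integral_const_mul,
    intervalIntegral.integral_const_mul, wsum_int, DD_integral]
  have h1 : ∑ j ∈ Finset.range w, (j : ℝ) ^ 2 ≤ w * (w : ℝ) ^ 2 := by
    calc ∑ j ∈ Finset.range w, (j : ℝ) ^ 2 ≤ ∑ j ∈ Finset.range w, (w : ℝ) ^ 2 := by
          refine Finset.sum_le_sum fun j hj => ?_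
          have : (j : ℝ) ≤ w := by exact_mod_cast (Finset.mem_range.mp hj).le
          gcongr
      _ = _ := by simp
  calc _ ≤ 1 / (w : ℝ) * (2 * π * (w * (w : ℝ) ^ 2)) + w * (2 * π * w) := by gcongr
    _ = _ := by field_simp; ring

lemma DD_deriv {w : ℕ} (hw : 1 ≤ w) (t : ℝ) : ∃ d, HasDerivAt (DD w) d t ∧ |d| ≤ GG w t := by
  have hw' : (0 : ℝ) < w := by positivity
  set A := ∑ j ∈ Finset.range w, Real.cos (j * t) with hA
  set B := ∑ j ∈ Finset.range w, Real.sin (j * t) with hB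
  set A' := ∑ j ∈ Finset.range w, (j : ℝ) * Real.cos (j * t) with hA'
  set B' := ∑ j ∈ Finset.range w, (j : ℝ) * Real.sin (j * t) with hB'
  have h1 : HasDerivAt (fun t => ∑ j ∈ Finset.range w, Real.cos (j * t)) (-B') t := by
    have : HasDerivAt (fun t => ∑ j ∈ Finset.range w, Real.cos (j * t))
        (∑ j ∈ Finset.range w, -Real.sin (j * t) * (j * 1)) t :=
      HasDerivAt.fun_sum fun j _ => ((hasDerivAt_id t).const_mul (j : ℝ)).cos
    convert this using 1
    rw [hB', ← Finset.sum_neg_distrib]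
    exact Finset.sum_congr rfl fun j _ => by ring
  have h2 : HasDerivAt (fun t => ∑ j ∈ Finset.range w, Real.sin (j * t)) A' t := by
    have : HasDerivAt (fun t => ∑ j ∈ Finset.range w, Real.sin (j * t))
        (∑ j ∈ Finset.range w, Real.cos (j * t) * (j * 1)) t :=
      HasDerivAt.fun_sum fun j _ => ((hasDerivAt_id t).const_mul (j : ℝ)).sin
    convert this using 1
    exact Finset.sum_congr rfl fun j _ => by ring
  refine ⟨_, (h1.pow 2).add (h2.pow 2), ?_⟩
  unfold GG DD
  rw [← hA, ← hB, ← hA', ← hB']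
  have key : 1 / (w : ℝ) * (A' ^ 2 + B' ^ 2) + w * (A ^ 2 + B ^ 2)
      = (1 / w) * ((A' - w * B) ^ 2 + (B' + w * A) ^ 2) + 2 * (A' * B - B' * A) := by
    field_simp; ring
  have key2 : 1 / (w : ℝ) * (A' ^ 2 + B' ^ 2) + w * (A ^ 2 + B ^ 2)
      = (1 / w) * ((A' + w * B) ^ 2 + (B' - w * A) ^ 2) - 2 * (A' * B - B' * A) := by
    field_simp; ring
  have p1 : 0 ≤ (1 / (w:ℝ)) * ((A' - w * B) ^ 2 + (B' + w * A) ^ 2) := by positivity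
  have p2 : 0 ≤ (1 / (w:ℝ)) * ((A' + w * B) ^ 2 + (B' - w * A) ^ 2) := by positivity
  rw [abs_le]
  push_cast
  constructor
  · linarith
  · linarith

lemma DD_diff {w : ℕ} (hw : 1 ≤ w) {a b s t : ℝ} (hs : s ∈ Set.Icc a b) (ht : t ∈ Set.Icc a b) :
    |DD w t - DD w s| ≤ ∫ u in a..b, GG w u := by
  choose d hd hb using DD_deriv hw
  have hdc : Continuous d := by
    have : d = deriv (DD w) := funext fun t => (hd t).deriv.symm
    rw [this]
    have hc : ContDiff ℝ 1 (DD w) := by unfold DD; fun_prop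
    exact hc.continuous_deriv le_rfl
  have hg := GG_cont w
  wlog hst : s ≤ t generalizing s t
  · rw [abs_sub_comm]; exact this ht hs (le_of_not_ge hst)
  rw [← intervalIntegral.integral_eq_sub_of_hasDerivAt (fun x _ => hd x) (hdc.intervalIntegrable _ _)]
  refine (intervalIntegral.abs_integral_le_integral_abs hst).trans ?_
  refine (intervalIntegral.integral_mono_on hst (hdc.abs.intervalIntegrable _ _)
    (hg.intervalIntegrable _ _) fun x _ => hb x).trans ?_
  refine intervalIntegral.integral_mono_interval hs.1 hst ht.2 ?_ (hg.intervalIntegrable _ _)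
  exact Filter.Eventually.of_forall fun x => GG_nonneg w x

lemma Nice_DDrr (n w : ℕ) (θ : ℝ) : Nice (fun t => DD w (rr n θ t)) :=
  ⟨(Nice.DD w).meas.comp (rr_meas n θ), by
    obtain ⟨M, hM⟩ := (Nice.DD w).bdd; exact ⟨M, fun t => hM _⟩⟩

lemma DD_step {n w : ℕ} (hn : 1 ≤ n) (hw : 1 ≤ w) (θ : ℝ) :
    ∫ t in (-π)..π, |DD w t - DD w (rr n θ t)| ≤ 8 * π ^ 2 * (w * (w - 1) / n) := by
  have hn' : (0 : ℝ) < n := by positivity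
  rcases hw.eq_or_lt with rfl | hw2
  · have : ∀ t, DD 1 t = 1 := fun t => by simp [DD]
    simp [this]
  have hN : Nice (fun t => DD w t - DD w (rr n θ t)) := by
    have := (Nice.DD w).add ((Nice_DDrr n w θ).smul (-1))
    simpa [sub_eq_add_neg] using this
  have hNa : Nice (fun t => |DD w t - DD w (rr n θ t)|) := ⟨hN.meas.abs, by
    obtain ⟨M, hM⟩ := hN.bdd; exact ⟨M, fun t => by rw [abs_abs]; exact hM t⟩⟩
  rw [cell_sum hn θ (fun t => by simp only [rr_per hn, DD_periodic w _]) (fun a b => hNa.ii a b)]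
  have hb : ∀ j : ℕ, ∫ t in (ce n θ j)..(ce n θ (j + 1)), |DD w t - DD w (rr n θ t)|
      ≤ π / n * ∫ t in (ce n θ j)..(ce n θ (j + 1)), GG w t := by
    intro j
    have h1 : ∫ t in (ce n θ j)..(ce n θ (j + 1)), |DD w t - DD w (rr n θ t)|
      ≤ ∫ t in (ce n θ j)..(ce n θ (j + 1)), ∫ u in (ce n θ j)..(ce n θ (j + 1)), GG w u := by
      refine intervalIntegral.integral_mono_on_of_le_Ioo (ce_le n θ j) (hNa.ii _ _) (by simp) fun t ht => ?_
      refine DD_diff hw ?_ ⟨ht.1.le, ht.2.le⟩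
      rw [rr_cell hn θ j ht.1.le ht.2]
      unfold ce
      have := pi_pos
      constructor
      · refine div_le_div_of_nonneg_right ?_ hn'.le
        linarith
      · refine div_le_div_of_nonneg_right ?_ hn'.le
        push_cast; linarith
    rw [intervalIntegral.integral_const, smul_eq_mul] at h1
    have : ce n θ (j + 1) - ce n θ j = π / n := by
      unfold ce; push_cast; field_simp; ring
    rwa [this] at h1
  refine (Finset.sum_le_sum fun j _ => hb j).trans ?_
  rw [← Finset.mul_sum, ← cell_sum hn θ (GG_per w) (fun a b => (GG_cont w).intervalIntegrable a b)]
  have hw2' : (2 : ℝ) ≤ w := by exact_mod_cast hw2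
  calc π / n * ∫ t in (-π)..π, GG w t ≤ π / n * (4 * π * (w : ℝ) ^ 2) := by
        have := GG_int hw; have := pi_pos; gcongr
    _ ≤ π / n * (4 * π * (2 * (w * (w - 1)))) := by
        have := pi_pos
        gcongr
        nlinarith
    _ = _ := by ring

/-- constant of the fine bound -/
def C4 : ℝ := 8 * π ^ 2 * CJ + 8 * π * (1 + π)

lemma C4_pos : 0 < C4 := by
  have := CJ_pos
  have := pi_pos
  unfold C4; positivity

lemma fine_DD {φ ω : ℝ → ℝ} (h : PI φ) (hω : IsModulus ω) (hφ : HL φ ω) {n w : ℕ} (hn : 1 ≤ n)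
    (hw : 1 ≤ w) (θ : ℝ) :
    Good n φ (fun t => Real.cos (n * t - θ) * DD w t)
      (2 * w * eN n ω + C4 * ω (1 / n) * (w * (w - 1) / n)) := by
  have hn' : (0 : ℝ) < n := by positivity
  have hpi := pi_pos
  have hw' : (1 : ℝ) ≤ w := by exact_mod_cast hw
  set S : ℝ := w * (w - 1) / n with hS
  have hS0 : 0 ≤ S := div_nonneg (mul_nonneg (by linarith) (by linarith)) hn'.le
  have hst := DD_step hn hw θ
  have he0 := eN_nonneg hω n
  have he1 := eN_le hω hn
  have hω1 : 0 ≤ ω (1 / n) := hω.2.2.2.2 _ (by positivity)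
  have hN : Nice (fun t => DD w t - DD w (rr n θ t)) := by
    have := (Nice.DD w).add ((Nice_DDrr n w θ).smul (-1))
    simpa [sub_eq_add_neg] using this
  have hint : ∫ t in (-π)..π, DD w (rr n θ t) ≤ 2 * π * w + 8 * π ^ 2 * S := by
    rw [← DD_integral w]
    refine le_trans ?_ (add_le_add le_rfl hst)
    rw [← intervalIntegral.integral_add ((Nice.DD w).ii _ _) (hN.ii _ _).abs]
    refine intervalIntegral.integral_mono_on negpi_le ((Nice_DDrr n w θ).ii _ _)
      (((Nice.DD w).ii _ _).add (hN.ii _ _).abs) fun t _ => ?_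
    have := neg_abs_le (DD w t - DD w (rr n θ t))
    linarith
  have g1 : Good n φ (fun t => Real.cos (n * t - θ) * DD w (rr n θ t))
      (eN n ω / π * (2 * π * w + 8 * π ^ 2 * S)) := by
    refine Good.of_norm ((step_norm h hω hφ hn θ (Nice.DD w) (DD_periodic w) (DD_nonneg w)).trans ?_)
    gcongr
  have hN2 : Nice (fun t => Real.cos (n * t - θ) * (DD w t - DD w (rr n θ t))) := (Nice.cos n θ).mul hN
  have g2 := Good.jackson h hω hφ hn hN2 (b := 8 * π ^ 2 * S) (by
    refine le_trans ?_ hst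
    refine intervalIntegral.integral_mono_on negpi_le (hN2.ii _ _).abs (hN.ii _ _).abs fun t _ => ?_
    rw [abs_mul]
    exact mul_le_of_le_one_left (abs_nonneg _) (abs_cos_le_one _))
  have g := Good.add h ((Nice.cos n θ).mul (Nice_DDrr n w θ)) hN2 g1 g2
  have e : (fun t => Real.cos (n * t - θ) * DD w (rr n θ t) + Real.cos (n * t - θ) * (DD w t - DD w (rr n θ t)))
      = fun t => Real.cos (n * t - θ) * DD w t := by
    funext t; ring
  rw [e] at g
  refine g.mono ?_
  have : eN n ω / π * (2 * π * w + 8 * π ^ 2 * S) = 2 * w * eN n ω + eN n ω * (8 * π * S) := by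
    field_simp
  rw [this]
  have : eN n ω * (8 * π * S) ≤ (1 + π) * ω (1 / n) * (8 * π * S) := by gcongr
  unfold C4
  nlinarith

/-- triangular one-sided kernels -/
def PW (n : ℕ) (θ : ℝ) (w : ℕ) (t : ℝ) : ℝ :=
  ∑ i ∈ Finset.range w, ∑ j ∈ Finset.range (i + 1), Real.cos ((n + j : ℕ) * t - θ)

/-- the reflected part -/
def LW (n : ℕ) (θ : ℝ) (w : ℕ) (t : ℝ) : ℝ :=
  ∑ i ∈ Finset.range w, ∑ j ∈ Finset.range i, Real.cos (((n : ℤ) - (j + 1 : ℕ) : ℤ) * t + -θ)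

lemma PW_nice (n : ℕ) (θ : ℝ) (w : ℕ) : Nice (PW n θ w) :=
  Nice.sum _ _ fun _ _ => Nice.sum _ _ fun _ _ => Nice.cos _ _

lemma DD_split (n : ℕ) (θ : ℝ) (w : ℕ) (t : ℝ) :
    Real.cos (n * t - θ) * DD w t = PW n θ w t + LW n θ w t := by
  induction w with
  | zero => simp [DD, PW, LW]
  | succ w ih =>
    rw [DD_succ, mul_add, ih]
    simp only [PW, LW]
    rw [Finset.sum_range_succ, Finset.sum_range_succ (fun i => ∑ j ∈ Finset.range i, Real.cos (((n : ℤ) - (j + 1 : ℕ) : ℤ) * t + -θ))]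
    have : Real.cos (n * t - θ) * (1 + 2 * ∑ j ∈ Finset.range w, Real.cos ((j + 1 : ℕ) * t))
      = ∑ j ∈ Finset.range (w + 1), Real.cos ((n + j : ℕ) * t - θ) +
        ∑ j ∈ Finset.range w, Real.cos (((n : ℤ) - (j + 1 : ℕ) : ℤ) * t + -θ) := by
      rw [Finset.sum_range_succ', add_right_comm, ← Finset.sum_add_distrib, mul_add, mul_one,
        Finset.mul_sum, Finset.mul_sum, add_comm]
      congr 1
      refine Finset.sum_congr rfl fun j _ => ?_
      push_cast
      have e1 : ((n : ℝ) + (j + 1)) * t - θ = (n * t - θ) + (j + 1) * t := by ring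
      have e2 : ((n : ℝ) - (j + 1)) * t + -θ = (n * t - θ) - (j + 1) * t := by ring
      rw [e1, e2]
      generalize (n * t - θ : ℝ) = X
      rw [Real.cos_add, Real.cos_sub]; ring
    rw [this]; ring

lemma LW_split {n : ℕ} (hn : 1 ≤ n) (θ : ℝ) (w : ℕ) :
    ∃ Q, IsTrigPoly n Q ∧ ∀ t, LW n θ w t = Q t + PW n (-θ) (w - 2 * n) t := by
  induction w with
  | zero => exact ⟨_, IsTrigPoly.zero, fun t => by simp [LW, PW]⟩
  | succ w ih =>
    obtain ⟨Q, hQ, h⟩ := ih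
    by_cases hw : w < 2 * n
    · refine ⟨_, hQ.add (IsTrigPoly.sum (Finset.range w)
        (fun j t => Real.cos (((n : ℤ) - (j + 1 : ℕ) : ℤ) * t + -θ)) fun j hj => IsTrigPoly.cosZ ?_ _), fun t => ?_⟩
      · have := Finset.mem_range.mp hj
        rw [abs_lt]; constructor <;> push_cast <;> omega
      · have h' := h t
        unfold LW at h' ⊢
        rw [Finset.sum_range_succ, h', show w + 1 - 2 * n = 0 by omega, show w - 2 * n = 0 by omega]
        simp only [PW]
        simp
    · obtain ⟨v, rfl⟩ : ∃ v, w = 2 * n + v := ⟨w - 2 * n, by omega⟩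
      refine ⟨_, hQ.add (IsTrigPoly.sum (Finset.range (2 * n - 1))
        (fun j t => Real.cos (((n : ℤ) - (j + 1 : ℕ) : ℤ) * t + -θ)) fun j hj => IsTrigPoly.cosZ ?_ _), fun t => ?_⟩
      · have := Finset.mem_range.mp hj
        rw [abs_lt]; constructor <;> push_cast <;> omega
      · have h' := h t
        unfold LW at h' ⊢
        rw [Finset.sum_range_succ, h', show 2 * n + v + 1 - 2 * n = v + 1 by omega,
          show 2 * n + v - 2 * n = v by omega]
        simp only [PW]
        rw [Finset.sum_range_succ (fun i => ∑ j ∈ Finset.range (i + 1), Real.cos ((n + j : ℕ) * t - -θ))]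
        have : ∑ j ∈ Finset.range (2 * n + v), Real.cos (((n : ℤ) - (j + 1 : ℕ) : ℤ) * t + -θ)
          = ∑ j ∈ Finset.range (2 * n - 1), Real.cos (((n : ℤ) - (j + 1 : ℕ) : ℤ) * t + -θ)
            + ∑ j ∈ Finset.range (v + 1), Real.cos ((n + j : ℕ) * t - -θ) := by
          rw [show 2 * n + v = (2 * n - 1) + (v + 1) by omega, Finset.sum_range_add]
          congr 1
          refine Finset.sum_congr rfl fun j _ => ?_
          rw [← Real.cos_neg]
          congr 1
          have : 2 * n - 1 + j + 1 = 2 * n + j := by omega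
          rw [this]; push_cast; ring
        rw [this]; ring

lemma PW_cont (n : ℕ) (θ : ℝ) (w : ℕ) : Continuous (PW n θ w) := by
  unfold PW; fun_prop

lemma PW_crude {n : ℕ} (hn : 1 ≤ n) (w : ℕ) : ∀ θ : ℝ, ∃ Q, IsTrigPoly n Q ∧
    ∫ t in (-π)..π, |PW n θ w t - Q t| ≤ 2 * π * w + π * w ^ 2 / n := by
  have hn' : (0 : ℝ) < n := by positivity
  have hpi := pi_pos
  induction w using Nat.strong_induction_on with
  | _ w ih =>
    intro θ
    obtain ⟨Q, hQ, h⟩ := LW_split hn θ w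
    have hDD : ∫ t in (-π)..π, |Real.cos (n * t - θ) * DD w t| ≤ 2 * π * w := by
      rw [← DD_integral w]
      refine intervalIntegral.integral_mono_on negpi_le (((Nice.cos n θ).mul (Nice.DD w)).ii _ _).abs
        ((Nice.DD w).ii _ _) fun t _ => ?_
      rw [abs_mul, abs_of_nonneg (DD_nonneg w t)]
      exact mul_le_of_le_one_left (DD_nonneg w t) (abs_cos_le_one _)
    by_cases hw : w < 2 * n
    · refine ⟨_, hQ.smul (-1), ?_⟩
      have e : ∀ t, PW n θ w t - -1 * Q t = Real.cos (n * t - θ) * DD w t := fun t => by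
        rw [DD_split, h, show w - 2 * n = 0 by omega]; simp [PW]
      simp_rw [e]
      have : 0 ≤ π * (w : ℝ) ^ 2 / n := by positivity
      linarith
    · obtain ⟨v, rfl⟩ : ∃ v, w = 2 * n + v := ⟨w - 2 * n, by omega⟩
      obtain ⟨R, hR, hb⟩ := ih v (by omega) (-θ)
      refine ⟨_, (hQ.add hR).smul (-1), ?_⟩
      have e : ∀ t, PW n θ (2 * n + v) t - -1 * (Q t + R t) = Real.cos (n * t - θ) * DD (2 * n + v) t
          - (PW n (-θ) v t - R t) := fun t => by
        rw [DD_split, h, show 2 * n + v - 2 * n = v by omega]; ring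
      simp_rw [e]
      have i1 := (((Nice.cos n θ).mul (Nice.DD (2 * n + v))).ii (-π) π)
      have i2 : IntervalIntegrable (fun t => PW n (-θ) v t - R t) volume (-π) π :=
        ((PW_cont n (-θ) v).sub hR.continuous).intervalIntegrable _ _
      have : ∫ t in (-π)..π, |Real.cos (n * t - θ) * DD (2 * n + v) t - (PW n (-θ) v t - R t)|
          ≤ (∫ t in (-π)..π, |Real.cos (n * t - θ) * DD (2 * n + v) t|) + ∫ t in (-π)..π, |PW n (-θ) v t - R t| := by
        rw [← intervalIntegral.integral_add i1.abs i2.abs]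
        exact intervalIntegral.integral_mono_on negpi_le (i1.sub i2).abs (i1.abs.add i2.abs) fun t _ => abs_sub _ _
      refine this.trans ((add_le_add hDD hb).trans ?_)
      push_cast
      have e3 : π * (2 * n + v : ℝ) ^ 2 / n = 4 * π * n + 4 * π * v + π * v ^ 2 / n := by
        field_simp; ring
      rw [e3]
      have : 0 ≤ π * v := by positivity
      have : 0 ≤ π * n := by positivity
      linarith

/-- constant -/
def C5 : ℝ := C4 + 4 * π * CJ

lemma C5_pos : 0 < C5 := by
  have := CJ_pos
  have := C4_pos
  have := pi_pos
  unfold C5; positivity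

lemma PW_good {φ ω : ℝ → ℝ} (h : PI φ) (hω : IsModulus ω) (hφ : HL φ ω) {n w : ℕ} (hn : 1 ≤ n)
    (hw : 1 ≤ w) (θ : ℝ) :
    Good n φ (PW n θ w) (2 * w * eN n ω + C5 * ω (1 / n) * (w * (w - 1) / n)) := by
  have hn' : (0 : ℝ) < n := by positivity
  have hpi := pi_pos
  have hw' : (1 : ℝ) ≤ w := by exact_mod_cast hw
  have hS0 : (0:ℝ) ≤ w * (w - 1) / n := div_nonneg (mul_nonneg (by linarith) (by linarith)) hn'.le
  have hω1 : 0 ≤ ω (1 / n) := hω.2.2.2.2 _ (by positivity)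
  have hCJ := CJ_pos
  have hC4 := C4_pos
  by_cases hwn : w ≤ 2 * n
  · obtain ⟨Q, hQ, hs⟩ := LW_split hn θ w
    have g := Good.add h ((Nice.cos n θ).mul (Nice.DD w)) (Nice.of_trig (hQ.smul (-1)))
      (fine_DD h hω hφ hn hw θ) (Good.trig h (hQ.smul (-1)))
    have e : (fun t => Real.cos (n * t - θ) * DD w t + -1 * Q t) = PW n θ w := by
      funext t
      rw [DD_split, hs, show w - 2 * n = 0 by omega]; simp [PW]
    rw [e] at g
    refine g.mono ?_
    have : 0 ≤ 4 * π * CJ * (ω (1 / n) * (w * (w - 1) / n)) := by positivity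
    unfold C5
    linarith
  · obtain ⟨Q, hQ, hb⟩ := PW_crude hn w θ
    have hN : Nice (fun t => PW n θ w t - Q t) := by
      have := (PW_nice n θ w).add (Nice.of_trig (hQ.smul (-1)))
      simpa [sub_eq_add_neg] using this
    have g := Good.add h hN (Nice.of_trig hQ) (Good.jackson h hω hφ hn hN hb) (Good.trig h hQ)
    have e : (fun t => PW n θ w t - Q t + Q t) = PW n θ w := by
      funext t; ring
    rw [e] at g
    refine g.mono ?_
    have hwn' : (2 * n : ℝ) ≤ w := by
      have : 2 * n ≤ w := by omega
      exact_mod_cast this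
    have hn1 : (1 : ℝ) ≤ n := by exact_mod_cast hn
    have b1 : 2 * π * w + π * w ^ 2 / n ≤ 4 * π * (w * (w - 1) / n) := by
      have e4 : 4 * π * ((w : ℝ) * (w - 1) / n) - (2 * π * w + π * w ^ 2 / n)
        = π * w * (4 * (w - 1) - 2 * n - w) / n := by field_simp; ring
      have : 0 ≤ π * w * (4 * ((w:ℝ) - 1) - 2 * n - w) / n := by
        apply div_nonneg _ hn'.le
        apply mul_nonneg (by positivity)
        linarith
      linarith
    have b2 : CJ * ω (1 / n) * (2 * π * w + π * w ^ 2 / n) ≤ CJ * ω (1 / n) * (4 * π * (w * (w - 1) / n)) := by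
      gcongr
    have b3 : 0 ≤ C4 * (ω (1 / n) * (w * (w - 1) / n)) := by positivity
    have b4 : 0 ≤ 2 * w * eN n ω := by have := eN_nonneg hω n; positivity
    unfold C5
    linarith

lemma psi_anti {ψ η : ℝ → ℝ} (h : IsMInfPlus ψ η) : AntitoneOn ψ (Set.Ici 1) := by
  obtain ⟨hpos, -, hconv, hlim, -⟩ := h
  intro x hx y hy hxy
  by_contra hlt
  push Not at hlt
  have : ∀ᶠ z in atTop, ψ y ≤ ψ z := by
    filter_upwards [eventually_ge_atTop y] with z hz
    have hz1 : z ∈ Set.Ici (1:ℝ) := le_trans (Set.mem_Ici.mp hy) hz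
    have := hconv.le_max_of_mem_Icc hx hz1 ⟨hxy, hz⟩
    rcases le_max_iff.mp this with h1 | h1
    · linarith
    · exact h1
  have := ge_of_tendsto hlim this
  linarith [hpos y hy]

lemma psi_half {ψ η : ℝ → ℝ} (h : IsMInfPlus ψ η) {n : ℕ} (hn : 1 ≤ n)
    (hμ : 2 < (n : ℝ) / (η n - n)) {t : ℝ} (ht : (n : ℝ) ≤ t) :
    ψ ((1 + (η n - n) / n) * t) ≤ ψ t / 2 := by
  have hn1 : (1 : ℝ) ≤ n := by exact_mod_cast hn
  have ha := psi_anti h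
  obtain ⟨hpos, -, hconv, hlim, hη, hmono, -⟩ := h
  have ht1 : 1 ≤ t := hn1.trans ht
  have hm := hmono (Set.mem_Ici.mpr hn1) (Set.mem_Ici.mpr ht1) ht
  simp only at hm
  obtain ⟨h1, h2⟩ := hη n hn1
  obtain ⟨h3, h4⟩ := hη t ht1
  rw [← h4]
  refine ha (Set.mem_Ici.mpr (ht1.trans h3.le)) ?_ ?_
  · rw [Set.mem_Ici]
    have : 0 ≤ (η n - n) / n := div_nonneg (by linarith) (by linarith)
    nlinarith
  · rw [div_le_div_iff₀ (by linarith) (by linarith)] at hm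
    have hn0 : (0 : ℝ) < n := by linarith
    have : η t - t ≤ t * (η n - n) / n := by
      rw [le_div_iff₀ hn0]; linarith
    have e : (1 + (η n - n) / n) * t = t + t * (η n - n) / n := by field_simp
    rw [e]; linarith

lemma psi_int {ψ η : ℝ → ℝ} (h : IsMInfPlus ψ η) {n : ℕ} (hn : 1 ≤ n)
    (hμ : 2 < (n : ℝ) / (η n - n)) {a X : ℝ} (ha : (n : ℝ) ≤ a) (hX : a ≤ X) :
    ∫ t in a..X, ψ t ≤ 4 * ((η n - n) / n * a) * ψ a := by
  have hn1 : (1 : ℝ) ≤ n := by exact_mod_cast hn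
  have hanti := psi_anti h
  have hhalf := fun t ht => psi_half (t := t) h hn hμ ht
  obtain ⟨hpos, hcont, hconv, hlim, hη, hmono, -⟩ := h
  have hd : 0 < η n - n := by linarith [(hη n hn1).1]
  set e := (η n - n) / n with he
  have he0 : 0 < e := div_pos hd (by linarith)
  have he1 : e < 1 / 2 := by
    rw [he, div_lt_iff₀ (by linarith)]
    rw [lt_div_iff₀ hd] at hμ; linarith
  set l := 1 + e with hl
  have ii : ∀ x y, 1 ≤ x → 1 ≤ y → IntervalIntegrable ψ volume x y := by
    intro x y hx hy
    apply ContinuousOn.intervalIntegrable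
    refine hcont.mono fun z hz => ?_
    exact le_trans (le_min hx hy) hz.1
  have ha1 : 1 ≤ a := hn1.trans ha
  have hX1 : 1 ≤ X := ha1.trans hX
  have hla : a ≤ l * a := by nlinarith
  have hlX : X ≤ l * X := by nlinarith
  have hlaX : l * a ≤ l * X := by have : 0 ≤ l := by linarith
                                  gcongr
  have s1 : ∫ t in a..X, ψ t ≤ ∫ t in a..(l * X), ψ t :=
    intervalIntegral.integral_mono_interval le_rfl hX hlX (by
      filter_upwards [ae_restrict_mem measurableSet_Ioc] with t ht
      exact (hpos t (by linarith [ht.1])).le) (ii _ _ ha1 (by linarith))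
  have s2 : ∫ t in a..(l * X), ψ t = (∫ t in a..(l * a), ψ t) + ∫ t in (l * a)..(l * X), ψ t :=
    (intervalIntegral.integral_add_adjacent_intervals (ii _ _ ha1 (by linarith)) (ii _ _ (by linarith) (by linarith))).symm
  have s3 : ∫ t in a..(l * a), ψ t ≤ e * a * ψ a := by
    have : ∫ t in a..(l * a), ψ t ≤ ∫ t in a..(l * a), ψ a :=
      intervalIntegral.integral_mono_on hla (ii _ _ ha1 (by linarith)) (by simp) fun t ht =>
        hanti ha1 (ha1.trans ht.1) ht.1
    rw [intervalIntegral.integral_const, smul_eq_mul] at this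
    refine this.trans (le_of_eq ?_)
    rw [hl]; ring
  have s4 : ∫ t in (l * a)..(l * X), ψ t ≤ l / 2 * ∫ t in a..X, ψ t := by
    have e1 := intervalIntegral.mul_integral_comp_mul_left (f := ψ) (a := a) (b := X) (c := l)
    rw [← e1, div_mul_eq_mul_div, mul_div_assoc]
    have hl0 : 0 ≤ l := by linarith
    refine mul_le_mul_of_nonneg_left ?_ hl0
    rw [← intervalIntegral.integral_div]
    refine intervalIntegral.integral_mono_on hX ?_ ((ii _ _ ha1 hX1).div_const _) fun t ht => hhalf t (ha.trans ht.1)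
    apply ContinuousOn.intervalIntegrable
    refine hcont.comp (by fun_prop) fun t ht => ?_
    rw [Set.uIcc_of_le hX] at ht
    rw [Set.mem_Ici]
    nlinarith [ht.1]
  have hI : 0 ≤ ∫ t in a..X, ψ t := intervalIntegral.integral_nonneg hX fun t ht => (hpos t (ha1.trans ht.1)).le
  nlinarith

lemma psi_sum {ψ η : ℝ → ℝ} (h : IsMInfPlus ψ η) {n : ℕ} (hn : 1 ≤ n)
    (hμ : 2 < (n : ℝ) / (η n - n)) (M : ℕ) :
    ∑ j ∈ Finset.range M, ψ ((n + 1 + j : ℕ) : ℝ) ≤ ψ (n + 1) * (1 + 8 * (η n - n)) := by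
  have hn1 : (1 : ℝ) ≤ n := by exact_mod_cast hn
  have hpos := h.1
  have hd : 0 < η n - n := by linarith [(h.2.2.2.2.1 n hn1).1]
  have hp1 := hpos (n + 1) (by linarith)
  cases M with
  | zero => simp; positivity
  | succ M =>
    rw [Finset.sum_range_succ']
    have h1 := AntitoneOn.sum_le_integral (f := ψ) (x₀ := (n : ℝ) + 1) (a := M)
      ((psi_anti h).mono fun x hx => by rw [Set.mem_Ici]; linarith [hx.1])
    have h2 := psi_int h hn hμ (a := (n : ℝ) + 1) (X := n + 1 + M) (by linarith) (by linarith [(Nat.cast_nonneg M : (0:ℝ) ≤ M)])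
    have e : ∑ j ∈ Finset.range M, ψ ((n + 1 + (j + 1) : ℕ) : ℝ) = ∑ i ∈ Finset.range M, ψ (n + 1 + (i + 1 : ℕ)) := by
      refine Finset.sum_congr rfl fun j _ => ?_
      push_cast; rfl
    rw [e]
    have h3 : (η n - n) / n * (n + 1) ≤ 2 * (η n - n) := by
      rw [div_mul_eq_mul_div, div_le_iff₀ (by linarith)]
      nlinarith
    have h4 : 4 * ((η n - n) / n * (n + 1)) * ψ (n + 1) ≤ 4 * (2 * (η n - n)) * ψ (n + 1) := by gcongr
    have e2 : ψ ((n + 1 + 0 : ℕ) : ℝ) = ψ (n + 1) := by push_cast; rw [add_zero]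
    rw [e2]
    linarith

lemma psi_summable {ψ η : ℝ → ℝ} (h : IsMInfPlus ψ η) {n : ℕ} (hn : 1 ≤ n)
    (hμ : 2 < (n : ℝ) / (η n - n)) : Summable (fun k : ℕ => ψ ((k : ℝ) + 1)) := by
  have := summable_of_sum_range_le (f := fun j : ℕ => ψ ((n + 1 + j : ℕ) : ℝ)) (fun j => (h.1 _ (by
    have : 1 ≤ n + 1 + j := by omega
    exact_mod_cast this)).le) (psi_sum h hn hμ)
  rw [← summable_nat_add_iff n]
  refine this.congr fun j => ?_
  congr 1; push_cast; ring

lemma gamma_bd {ψ η : ℝ → ℝ} (h : IsMInfPlus ψ η) {n : ℕ} (hn : 1 ≤ n)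
    (hμ : 2 < (n : ℝ) / (η n - n)) :
    1 / n * (ψ (n + 1) * (1 + 8 * (η n - n))) ≤ 8 * gammaN ψ η n ∧ ψ (3 * n) ≤ gammaN ψ η n
      ∧ 0 < gammaN ψ η n := by
  have hn1 : (1 : ℝ) ≤ n := by exact_mod_cast hn
  have hd : 0 < η n - n := by linarith [(h.2.2.2.2.1 n hn1).1]
  have hp1 := h.1 (n + 1) (by linarith)
  have hp3 := h.1 (3 * n) (by linarith)
  set μ := (n : ℝ) / (η n - n) with hμd
  have hdn : (η n - n) / n = 1 / μ := by rw [hμd]; field_simp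
  have h1 : 1 / μ ≤ 1 / (μ - 2) := one_div_le_one_div_of_le (by linarith) (by linarith)
  have h2 : 0 ≤ max 0 (Real.log (η n - n)) := le_max_left _ _
  have h3 : 0 ≤ ψ (3 * n) * max 0 (Real.log (η n - n)) := mul_nonneg hp3.le h2
  have h4 : 0 < ψ (n + 1) * (1 / n + 1 / (μ - 2)) :=
    mul_pos hp1 (add_pos (by positivity) (one_div_pos.mpr (by linarith)))
  have e : 1 / n * (ψ (n + 1) * (1 + 8 * (η n - n))) = ψ (n + 1) * (1 / n) + 8 * (ψ (n + 1) * (1 / μ)) := by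
    rw [← hdn]; field_simp
  have h5 : ψ (n + 1) * (1 / μ) ≤ ψ (n + 1) * (1 / (μ - 2)) := mul_le_mul_of_nonneg_left h1 hp1.le
  have h6 : 0 < ψ (n + 1) * (1 / n) := by positivity
  unfold gammaN
  rw [← hμd, e]
  refine ⟨?_, ?_, ?_⟩ <;> nlinarith

lemma abel1 (q X : ℕ → ℝ) (W : ℕ) :
    ∑ j ∈ Finset.range W, q j * X j = ∑ i ∈ Finset.range W, (q i - q (i + 1)) * ∑ j ∈ Finset.range (i + 1), X j
      + q W * ∑ j ∈ Finset.range W, X j := by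
  induction W with
  | zero => simp
  | succ W ih =>
    rw [Finset.sum_range_succ, ih, Finset.sum_range_succ (fun i => (q i - q (i + 1)) * ∑ j ∈ Finset.range (i + 1), X j),
      Finset.sum_range_succ X]
    ring

lemma abel2 (q X : ℕ → ℝ) (W : ℕ) (h0 : q W = 0) (h1 : q (W + 1) = 0) :
    ∑ j ∈ Finset.range W, q j * X j = ∑ i ∈ Finset.range W, (q i - 2 * q (i + 1) + q (i + 2)) *
      ∑ k ∈ Finset.range (i + 1), ∑ j ∈ Finset.range (k + 1), X j := by
  rw [abel1, abel1 (fun i => q i - q (i + 1)), h0, h1]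
  simp only [sub_self, zero_mul, add_zero]
  exact Finset.sum_congr rfl fun i _ => by ring

lemma conv_good {φ ω : ℝ → ℝ} (h : PI φ) (hω : IsModulus ω) (hφ : HL φ ω) {n : ℕ} (hn : 1 ≤ n)
    (θ : ℝ) (q : ℕ → ℝ) (W : ℕ) (hW : 1 ≤ W) (h0 : q W = 0) (h1 : q (W + 1) = 0)
    (hc : ∀ i, 0 ≤ q i - 2 * q (i + 1) + q (i + 2)) :
    Good n φ (fun t => ∑ j ∈ Finset.range W, q j * Real.cos ((n + j : ℕ) * t - θ))
      (2 * eN n ω * q 0 + C5 * ω (1 / n) * (2 / n * ∑ j ∈ Finset.range (W - 1), q (j + 1))) := by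
  have hn' : (0 : ℝ) < n := by positivity
  have e : (fun t => ∑ j ∈ Finset.range W, q j * Real.cos ((n + j : ℕ) * t - θ))
      = fun t => ∑ i ∈ Finset.range W, (q i - 2 * q (i + 1) + q (i + 2)) * PW n θ (i + 1) t := by
    funext t
    rw [abel2 q _ W h0 h1]; rfl
  rw [e]
  have g := Good.sum h (Finset.range W) (fun i t => (q i - 2 * q (i + 1) + q (i + 2)) * PW n θ (i + 1) t)
    _ (fun i _ => (PW_nice n θ (i + 1)).smul _) (fun i _ => (PW_good h hω hφ hn (by omega : 1 ≤ i + 1) θ).smul _)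
  refine g.mono (le_of_eq ?_)
  have e0 : q 0 = ∑ i ∈ Finset.range W, (q i - 2 * q (i + 1) + q (i + 2)) * (i + 1 : ℕ) := by
    have := abel2 q (fun j => if j = 0 then 1 else 0) W h0 h1
    rw [Finset.sum_eq_single 0 (by intro b _ hb; simp [hb]) (by intro hb; simp at hb; omega)] at this
    simp only [if_true, mul_one] at this
    rw [this]
    refine Finset.sum_congr rfl fun i _ => ?_
    congr 1
    simp
  have e1 : ∑ j ∈ Finset.range (W - 1), q (j + 1) = ∑ i ∈ Finset.range W, (q i - 2 * q (i + 1) + q (i + 2)) * ((i + 1 : ℕ) * ((i + 1 : ℕ) - 1 : ℝ) / 2) := by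
    have := abel2 q (fun j => if j = 0 then 0 else 1) W h0 h1
    obtain ⟨V, rfl⟩ : ∃ V, W = V + 1 := ⟨W - 1, by omega⟩
    rw [Finset.sum_range_succ'] at this
    simp only [if_true, mul_zero, add_zero, Nat.add_eq_zero_iff, one_ne_zero, and_false, if_false, mul_one] at this
    rw [Nat.add_sub_cancel, this]
    refine Finset.sum_congr rfl fun i _ => ?_
    congr 1
    have a : ∀ k : ℕ, ∑ j ∈ Finset.range (k + 1), (if j = 0 then (0:ℝ) else 1) = k := fun k => by
      rw [Finset.sum_range_succ']; simp
    simp_rw [a]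
    have b : ∀ m : ℕ, ∑ k ∈ Finset.range m, (k : ℝ) = m * (m - 1) / 2 := fun m => by
      induction m with
      | zero => simp
      | succ m ih => rw [Finset.sum_range_succ, ih]; push_cast; ring
    rw [b]
  rw [e1]
  conv_rhs => rw [e0]
  rw [Finset.mul_sum, Finset.mul_sum, Finset.mul_sum, ← Finset.sum_add_distrib]
  refine Finset.sum_congr rfl fun i _ => ?_
  rw [abs_of_nonneg (hc i)]
  field_simp

lemma psiKer_summable {ψ : ℝ → ℝ} (hpos : ∀ t ≥ (1:ℝ), 0 < ψ t)
    (hs : Summable (fun k : ℕ => ψ ((k : ℝ) + 1))) (θ t : ℝ) :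
    Summable (fun k : ℕ => ψ ((k : ℝ) + 1) * Real.cos ((k + 1) * t - θ)) := by
  refine Summable.of_norm_bounded hs fun k => ?_
  rw [Real.norm_eq_abs, abs_mul, abs_of_pos (hpos _ (by linarith [(Nat.cast_nonneg k : (0:ℝ) ≤ k)]))]
  exact mul_le_of_le_one_right (hpos _ (by linarith [(Nat.cast_nonneg k : (0:ℝ) ≤ k)])).le (abs_cos_le_one _)

lemma psiKer_cont {ψ : ℝ → ℝ} (hpos : ∀ t ≥ (1:ℝ), 0 < ψ t)
    (hs : Summable (fun k : ℕ => ψ ((k : ℝ) + 1))) (β : ℝ) : Continuous (PsiKer ψ β) := by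
  unfold PsiKer
  refine continuous_tsum (fun k => by fun_prop) hs fun k t => ?_
  rw [Real.norm_eq_abs, abs_mul, abs_of_pos (hpos _ (by linarith [(Nat.cast_nonneg k : (0:ℝ) ≤ k)]))]
  exact mul_le_of_le_one_right (hpos _ (by linarith [(Nat.cast_nonneg k : (0:ℝ) ≤ k)])).le (abs_cos_le_one _)

lemma psiKer_nice {ψ : ℝ → ℝ} (hpos : ∀ t ≥ (1:ℝ), 0 < ψ t)
    (hs : Summable (fun k : ℕ => ψ ((k : ℝ) + 1))) (β : ℝ) : Nice (PsiKer ψ β) := by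
  refine ⟨(psiKer_cont hpos hs β).measurable, ∑' k : ℕ, ψ ((k : ℝ) + 1), fun t => ?_⟩
  unfold PsiKer
  rw [← Real.norm_eq_abs]
  refine tsum_of_norm_bounded hs.hasSum fun k => ?_
  rw [Real.norm_eq_abs, abs_mul, abs_of_pos (hpos _ (by linarith [(Nat.cast_nonneg k : (0:ℝ) ≤ k)]))]
  exact mul_le_of_le_one_right (hpos _ (by linarith [(Nat.cast_nonneg k : (0:ℝ) ≤ k)])).le (abs_cos_le_one _)

/-- constant of the upper bound -/
def C6 : ℝ := 16 * C5 + 2 * π * CJ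

lemma C6_pos : 0 < C6 := by
  have := CJ_pos
  have := C5_pos
  have := pi_pos
  unfold C6; positivity

lemma psi_good {φ ω : ℝ → ℝ} (h : PI φ) (hω : IsModulus ω) (hφ : HL φ ω) {ψ η : ℝ → ℝ}
    (hψ : IsMInfPlus ψ η) {n : ℕ} (hn : 1 ≤ n)
    (hμ : 2 < (n : ℝ) / (η n - n)) (β : ℝ) :
    Good n φ (PsiKer ψ β) (2 * ψ n * eN n ω + C6 * gammaN ψ η n * ω (1 / n)) := by
  have hn1 : (1 : ℝ) ≤ n := by exact_mod_cast hn
  have hn' : (0 : ℝ) < n := by linarith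
  have hω1 : 0 ≤ ω (1 / n) := hω.2.2.2.2 _ (by positivity)
  have he0 := eN_nonneg hω n
  have hpos := hψ.1
  have hs := psi_summable hψ hn hμ
  obtain ⟨hg1, -, hg0⟩ := gamma_bd hψ hn hμ
  set θ := β * π / 2 with hθ
  set γ := gammaN ψ η n with hγ
  have hN : ∀ j : ℕ, (1 : ℝ) ≤ ((n + j : ℕ) : ℝ) := fun j => by
    have : 1 ≤ n + j := by omega
    exact_mod_cast this
  have hp : ∀ j : ℕ, 0 < ψ ((n + j : ℕ) : ℝ) := fun j => hpos _ (hN j)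
  have hs' : Summable (fun j : ℕ => ψ ((n + j : ℕ) : ℝ)) := by
    rw [← summable_nat_add_iff (n - 1)] at hs
    refine hs.congr fun j => ?_
    congr 1
    have : j + (n - 1) + 1 = n + j := by omega
    rw [← this]; push_cast; ring
  -- choose ε
  obtain ⟨ε, hε0, hε⟩ : ∃ ε : ℝ, 0 < ε ∧ ∑' j : ℕ, min ε (ψ ((n + j : ℕ) : ℝ)) < γ := by
    have ht : Tendsto (fun m : ℕ => ∑' j : ℕ, min (1 / ((m : ℝ) + 1)) (ψ ((n + j : ℕ) : ℝ))) atTop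
        (nhds (∑' j : ℕ, (0 : ℝ))) := by
      refine tendsto_tsum_of_dominated_convergence hs' (fun j => ?_) (Filter.Eventually.of_forall fun m j => ?_)
      · have := (tendsto_one_div_add_atTop_nhds_zero_nat (𝕜 := ℝ)).min (tendsto_const_nhds (x := ψ ((n + j : ℕ) : ℝ)))
        rwa [min_eq_left (hp j).le] at this
      · rw [Real.norm_eq_abs, abs_of_nonneg (le_min (by positivity) (hp j).le)]
        exact min_le_right _ _
    rw [tsum_zero] at ht
    obtain ⟨m, hm⟩ := (ht.eventually_lt_const hg0).exists
    exact ⟨1 / ((m : ℝ) + 1), by positivity, hm⟩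
  have hsε : Summable (fun j : ℕ => min ε (ψ ((n + j : ℕ) : ℝ))) :=
    Summable.of_nonneg_of_le (fun j => le_min hε0.le (hp j).le) (fun j => min_le_right _ _) hs'
  set q : ℕ → ℝ := fun j => max (ψ ((n + j : ℕ) : ℝ) - ε) 0 with hq
  have hq0 : ∀ j, 0 ≤ q j := fun j => le_max_right _ _
  have hqψ : ∀ j, q j ≤ ψ ((n + j : ℕ) : ℝ) := fun j => max_le (by linarith) (hp j).le
  have hqd : ∀ j, ψ ((n + j : ℕ) : ℝ) - q j = min ε (ψ ((n + j : ℕ) : ℝ)) := fun j => by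
    simp only [hq]
    rcases le_total ε (ψ ((n + j : ℕ) : ℝ)) with h1 | h1
    · rw [max_eq_left (by linarith), min_eq_left h1]; ring
    · rw [max_eq_right (by linarith), min_eq_right h1]; ring
  obtain ⟨W, hW1, hWz⟩ : ∃ W : ℕ, 1 ≤ W ∧ ∀ j ≥ W, q j = 0 := by
    have := (hs'.tendsto_atTop_zero).eventually_lt_const hε0
    obtain ⟨W, hW⟩ := eventually_atTop.mp this
    refine ⟨W + 1, by omega, fun j hj => max_eq_right ?_⟩
    linarith [hW j (by omega)]
  have hconv : ∀ i, 0 ≤ q i - 2 * q (i + 1) + q (i + 2) := fun i => by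
    have hc : 2 * ψ ((n + (i + 1) : ℕ) : ℝ) ≤ ψ ((n + i : ℕ) : ℝ) + ψ ((n + (i + 2) : ℕ) : ℝ) := by
      have := hψ.2.2.1.2 (Set.mem_Ici.mpr (hN i)) (Set.mem_Ici.mpr (hN (i + 2)))
        (by norm_num : (0 : ℝ) ≤ 1 / 2) (by norm_num : (0 : ℝ) ≤ 1 / 2) (by norm_num)
      simp only [smul_eq_mul] at this
      have e : (1 / 2 : ℝ) * ((n + i : ℕ) : ℝ) + 1 / 2 * ((n + (i + 2) : ℕ) : ℝ) = ((n + (i + 1) : ℕ) : ℝ) := by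
        push_cast; ring
      rw [e] at this
      linarith
    have a1 := hq0 i
    have a2 := hq0 (i + 2)
    have b1 : ψ ((n + i : ℕ) : ℝ) - ε ≤ q i := le_max_left _ _
    have b2 : ψ ((n + (i + 2) : ℕ) : ℝ) - ε ≤ q (i + 2) := le_max_left _ _
    have : q (i + 1) ≤ (q i + q (i + 2)) / 2 := max_le (by linarith) (by linarith)
    linarith
  have g1 := conv_good h hω hφ hn θ q W hW1 (hWz W le_rfl) (hWz (W + 1) (by omega)) hconv
  set K1 : ℝ → ℝ := fun t => ∑ j ∈ Finset.range W, q j * Real.cos ((n + j : ℕ) * t - θ) with hK1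
  have hK1N : Nice K1 := Nice.sum _ _ fun j _ => (Nice.cos _ _).smul _
  set K0 : ℝ → ℝ := fun t => ∑ k ∈ Finset.range (n - 1), ψ ((k : ℝ) + 1) * Real.cos (((k + 1 : ℕ) : ℝ) * t - θ) with hK0
  have hK0T : IsTrigPoly n K0 := IsTrigPoly.sum _ _ fun k hk => (IsTrigPoly.cosSub (by
    have := Finset.mem_range.mp hk; omega) θ).smul _
  have hPN := psiKer_nice hpos hs β
  set R : ℝ → ℝ := fun t => PsiKer ψ β t + (-1) * (K0 t + K1 t) with hR
  have hRN : Nice R := hPN.add (((Nice.of_trig hK0T).add hK1N).smul (-1))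
  have hRb : ∀ t, |R t| ≤ γ := by
    intro t
    have hsk := psiKer_summable hpos hs θ t
    have e1 : PsiKer ψ β t = K0 t + ∑' j : ℕ, ψ ((n + j : ℕ) : ℝ) * Real.cos ((n + j : ℕ) * t - θ) := by
      unfold PsiKer
      rw [← hsk.sum_add_tsum_nat_add (n - 1)]
      congr 1
      · simp only [hK0]
        refine Finset.sum_congr rfl fun k _ => ?_
        push_cast; rfl
      · refine tsum_congr fun j => ?_
        have : ((n + j : ℕ) : ℝ) = ((j + (n - 1) : ℕ) : ℝ) + 1 := by
          have : n + j = j + (n - 1) + 1 := by omega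
          rw [this]; push_cast; ring
        rw [this]
    have e2 : K1 t = ∑' j : ℕ, q j * Real.cos ((n + j : ℕ) * t - θ) := by
      rw [tsum_eq_sum (s := Finset.range W)]
      intro j hj
      rw [hWz j (by simpa using hj), zero_mul]
    have sm1 : Summable (fun j : ℕ => ψ ((n + j : ℕ) : ℝ) * Real.cos ((n + j : ℕ) * t - θ)) := by
      refine Summable.of_norm_bounded hs' fun k => ?_
      rw [Real.norm_eq_abs, abs_mul, abs_of_pos (hp k)]
      exact mul_le_of_le_one_right (hp k).le (abs_cos_le_one _)
    have sm2 : Summable (fun j : ℕ => q j * Real.cos ((n + j : ℕ) * t - θ)) := by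
      refine Summable.of_norm_bounded hs' fun k => ?_
      rw [Real.norm_eq_abs, abs_mul, abs_of_nonneg (hq0 k)]
      exact (mul_le_of_le_one_right (hq0 k) (abs_cos_le_one _)).trans (hqψ k)
    have e3 : R t = ∑' j : ℕ, (ψ ((n + j : ℕ) : ℝ) - q j) * Real.cos ((n + j : ℕ) * t - θ) := by
      simp only [hR]
      rw [e1, e2]
      simp_rw [sub_mul]
      rw [sm1.tsum_sub sm2]; ring
    rw [e3, ← Real.norm_eq_abs]
    refine (tsum_of_norm_bounded hsε.hasSum fun j => ?_).trans hε.le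
    rw [Real.norm_eq_abs, abs_mul, hqd, abs_of_nonneg (le_min hε0.le (hp j).le)]
    exact mul_le_of_le_one_right (le_min hε0.le (hp j).le) (abs_cos_le_one _)
  have g2 := Good.jackson h hω hφ hn hRN (b := 2 * π * γ) (by
    calc ∫ t in (-π)..π, |R t| ≤ ∫ t in (-π)..π, γ :=
          intervalIntegral.integral_mono_on negpi_le (hRN.ii _ _).abs (by simp) fun t _ => hRb t
      _ = _ := by rw [intervalIntegral.integral_const, smul_eq_mul]; ring)
  have g := Good.add h hRN ((Nice.of_trig hK0T).add hK1N) g2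
    (Good.add h (Nice.of_trig hK0T) hK1N (Good.trig h hK0T) g1)
  have e : (fun t => R t + (K0 t + K1 t)) = PsiKer ψ β := by
    funext t; simp only [hR]; ring
  rw [e] at g
  refine g.mono ?_
  have b1 : ∑ j ∈ Finset.range (W - 1), q (j + 1) ≤ ψ (n + 1) * (1 + 8 * (η n - n)) := by
    refine (Finset.sum_le_sum fun j _ => ?_).trans (psi_sum hψ hn hμ (W - 1))
    refine (hqψ (j + 1)).trans (le_of_eq ?_)
    congr 2; omega
  have b2 : 2 / n * ∑ j ∈ Finset.range (W - 1), q (j + 1) ≤ 16 * γ := by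
    have : 2 / n * ∑ j ∈ Finset.range (W - 1), q (j + 1) ≤ 2 / n * (ψ (n + 1) * (1 + 8 * (η n - n))) := by gcongr
    refine this.trans ?_
    calc _ = 2 * (1 / n * (ψ (n + 1) * (1 + 8 * (η n - n)))) := by ring
      _ ≤ _ := by linarith
  have b3 : 2 * eN n ω * q 0 ≤ 2 * ψ n * eN n ω := by
    have := hqψ 0
    rw [Nat.add_zero] at this
    nlinarith
  have hC5 := C5_pos
  have b4 : C5 * ω (1 / n) * (2 / n * ∑ j ∈ Finset.range (W - 1), q (j + 1)) ≤ C5 * ω (1 / n) * (16 * γ) := by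
    gcongr
  unfold C6
  nlinarith

lemma EnL1_bdd (n : ℕ) (f : ℝ → ℝ) :
    BddBelow {e | ∃ T : ℝ → ℝ, IsTrigPoly n T ∧ e = ∫ x in (-π)..π, |f x - T x|} := by
  refine ⟨0, ?_⟩
  rintro e ⟨T, -, rfl⟩
  exact intervalIntegral.integral_nonneg negpi_le fun x _ => abs_nonneg _

lemma upper {ω : ℝ → ℝ} (hω : IsModulus ω) {ψ η : ℝ → ℝ}
    (hψ : IsMInfPlus ψ η) {n : ℕ} (hn : 1 ≤ n)
    (hμ : 2 < (n : ℝ) / (η n - n)) (β : ℝ) {f : ℝ → ℝ} (hf : f ∈ L1Class ψ β ω) :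
    EnL1 n f ≤ (2 / π) * ψ n * eN n ω + C6 * gammaN ψ η n * ω (1 / n) := by
  have hpi := pi_pos
  obtain ⟨-, -, a₀, φ, hφi, hφp, -, hφω, hfe⟩ := hf
  have h : PI φ := ⟨hφi, hφp⟩
  have hL : HL φ ω := fun t => hφω |t| (abs_nonneg t) t le_rfl
  obtain ⟨T, hT, hb⟩ := psi_good h hω hL hψ hn hμ β
  have hle : EnL1 n f ≤ ∫ x in (-π)..π, |f x - (a₀ / 2 + 1 / π * T x)| :=
    csInf_le (EnL1_bdd n f) ⟨_, (IsTrigPoly.const hn (a₀ / 2)).add (hT.smul (1 / π)), rfl⟩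
  have e : ∫ x in (-π)..π, |f x - (a₀ / 2 + 1 / π * T x)| = 1 / π * ∫ x in (-π)..π, |cv φ (PsiKer ψ β) x - T x| := by
    rw [← intervalIntegral.integral_const_mul]
    refine intervalIntegral.integral_congr_ae ?_
    filter_upwards [hfe] with x hx _
    rw [hx]
    have : a₀ / 2 + 1 / π * (∫ t in (-π)..π, φ (x - t) * PsiKer ψ β t) - (a₀ / 2 + 1 / π * T x)
        = 1 / π * (cv φ (PsiKer ψ β) x - T x) := by unfold cv; ring
    rw [this, abs_mul, abs_of_pos (by positivity)]
  rw [e] at hle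
  refine hle.trans ((mul_le_mul_of_nonneg_left hb (by positivity)).trans ?_)
  obtain ⟨-, -, hg0⟩ := gamma_bd hψ hn hμ
  have hC6 := C6_pos
  have hω1 : 0 ≤ ω (1 / n) := hω.2.2.2.2 _ (by positivity)
  have h1 : 1 / π ≤ 1 := by rw [div_le_one hpi]; linarith [pi_gt_three]
  have h2 : 1 / π * (C6 * gammaN ψ η n * ω (1 / n)) ≤ C6 * gammaN ψ η n * ω (1 / n) :=
    mul_le_of_le_one_left (by positivity) h1
  rw [mul_add]
  refine add_le_add (le_of_eq ?_) h2
  ring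

lemma per_scale {F : ℝ → ℝ} (hF : Function.Periodic F (2 * π))
    (hi : ∀ a b, IntervalIntegrable F volume a b) {n : ℕ} (hn : 1 ≤ n) :
    ∫ x in (-π)..π, F (n * x) = ∫ x in (-π)..π, F x := by
  have hn' : (n : ℝ) ≠ 0 := by positivity
  rw [intervalIntegral.integral_comp_mul_left F hn', smul_eq_mul]
  have h := hF.intervalIntegral_add_zsmul_eq (n : ℤ) (n * -π) hi
  have e : (n : ℝ) * -π + (n : ℤ) • (2 * π) = n * π := by
    simp; ring
  rw [e, ← per_shift' hF] at h
  rw [h]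
  simp
  field_simp

/-- density -/
def pp (n : ℕ) (ω : ℝ → ℝ) (v : ℝ) : ℝ := ω (abs (π - 2 * abs v) / n)

/-- odd primitive -/
def gg (n : ℕ) (ω : ℝ → ℝ) (y : ℝ) : ℝ := 1 / 8 * ∫ v in (0:ℝ)..y, pp n ω v

/-- extremal profile -/
def GE (n : ℕ) (ω : ℝ → ℝ) (x : ℝ) : ℝ := gg n ω (Real.arcsin (Real.cos x))

section ext
variable {n : ℕ} {ω : ℝ → ℝ}

lemma pp_cont (hω : IsModulus ω) : Continuous (pp n ω) := by
  unfold pp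
  refine hω.1.comp_continuous (by fun_prop) fun v => ?_
  exact Set.mem_Ici.mpr (by positivity)

lemma pp_nonneg (hω : IsModulus ω) (v : ℝ) : 0 ≤ pp n ω v :=
  hω.2.2.2.2 _ (by positivity)

lemma gg_deriv (hω : IsModulus ω) (y : ℝ) : HasDerivAt (gg n ω) (1 / 8 * pp n ω y) y :=
  ((pp_cont hω).integral_hasStrictDerivAt 0 y).hasDerivAt.const_mul _

lemma gg_cont (hω : IsModulus ω) : Continuous (gg n ω) :=
  continuous_iff_continuousAt.mpr fun y => (gg_deriv hω y).continuousAt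

lemma gg_odd (y : ℝ) : gg n ω (-y) = - gg n ω y := by
  unfold gg
  have := intervalIntegral.integral_comp_neg (a := 0) (b := y) (pp n ω)
  rw [neg_zero] at this
  have e : ∀ v, pp n ω (-v) = pp n ω v := fun v => by simp [pp]
  simp_rw [e] at this
  have h2 := intervalIntegral.integral_symm (f := pp n ω) (μ := volume) (-y) 0
  linarith

lemma gg_mono (hω : IsModulus ω) : Monotone (gg n ω) :=
  monotone_of_deriv_nonneg (fun y => (gg_deriv hω y).differentiableAt) fun y => by
    rw [(gg_deriv hω y).deriv]
    have := pp_nonneg (n := n) hω y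
    positivity

lemma GE_cont (hω : IsModulus ω) : Continuous (GE n ω) :=
  (gg_cont hω).comp (Real.continuous_arcsin.comp Real.continuous_cos)

lemma GE_per : Function.Periodic (GE n ω) (2 * π) := fun x => by
  unfold GE; rw [Real.cos_add_two_pi]

lemma GE_even (x : ℝ) : GE n ω (-x) = GE n ω x := by
  unfold GE; rw [Real.cos_neg]

lemma GE_anti (x : ℝ) : GE n ω (x + π) = - GE n ω x := by
  unfold GE; rw [Real.cos_add_pi, Real.arcsin_neg, gg_odd]

lemma GE_Icc {x : ℝ} (h0 : 0 ≤ x) (h1 : x ≤ π) : GE n ω x = gg n ω (π / 2 - x) := by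
  unfold GE
  rw [← Real.sin_pi_div_two_sub, Real.arcsin_sin (by linarith) (by linarith)]

lemma gg_eq {x : ℝ} (h0 : 0 ≤ x) (h1 : x ≤ π / 2) :
    gg n ω (π / 2 - x) = 1 / 8 * ∫ y in x..(π / 2), ω (2 * y / n) := by
  unfold gg
  congr 1
  have := intervalIntegral.integral_comp_sub_left (a := x) (b := π / 2) (fun v => pp n ω v) (π / 2)
  rw [sub_self] at this
  rw [← this]
  refine intervalIntegral.integral_congr fun y hy => ?_
  rw [Set.uIcc_of_le h1] at hy
  simp only [pp]
  rw [abs_of_nonneg (by linarith [hy.2] : 0 ≤ π / 2 - y), abs_of_nonneg (by linarith [hy.1])]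
  congr 2; ring

lemma gg_bound (hω : IsModulus ω) (hn : 1 ≤ n) {a x : ℝ} (ha : 0 < a) (ha' : a ≤ π / 2) (hx : 0 ≤ x) (hxa : x ≤ a) :
    8 * gg n ω (π / 2 - x) ≤ (a - x + (π ^ 2 / 6 / a - a / 2)) * ω (2 * a / n) := by
  have hn' : (0 : ℝ) < n := by positivity
  have hpi := pi_pos
  set Ω := ω (2 * a / n) with hΩ
  have hΩ0 : 0 ≤ Ω := hω.2.2.2.2 _ (by positivity)
  have mono : ∀ y z, 0 ≤ y → y ≤ z → ω (2 * y / n) ≤ ω (2 * z / n) := fun y z hy hz => by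
    refine hω.2.1 (Set.mem_Ici.mpr (by positivity)) (Set.mem_Ici.mpr (by have := hy.trans hz; positivity)) ?_
    gcongr
  have two : ω (2 * (2 * a) / n) ≤ 2 * Ω := by
    have := hω.2.2.1 (2 * a / n) (2 * a / n) (by positivity) (by positivity)
    rw [show 2 * (2 * a) / (n:ℝ) = 2 * a / n + 2 * a / n by ring]
    linarith
  have rat : ∀ y, 0 ≤ y → ω (2 * y / n) ≤ (1 + y / a) * Ω := fun y hy => by
    have := mod_ratio hω (s := 2 * a / n) (t := 2 * y / n) (by positivity) (by positivity)
    have e : 2 * y / n / (2 * a / n) = y / a := by field_simp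
    rwa [e] at this
  have ii : ∀ y z, 0 ≤ y → 0 ≤ z → IntervalIntegrable (fun y => ω (2 * y / n)) volume y z := by
    intro y z hy hz
    have := ω_cont_ii hω (2 / n) (by positivity) hy hz (continuous_const (y := (1:ℝ)))
    refine this.congr fun u _ => ?_
    simp only [mul_one]
    rw [div_mul_eq_mul_div]
  rw [gg_eq hx (hxa.trans ha'), ← intervalIntegral.integral_add_adjacent_intervals (ii x a hx ha.le) (ii a (π/2) ha.le (by positivity))]
  have s1 : ∫ y in x..a, ω (2 * y / n) ≤ (a - x) * Ω := by
    have : ∫ y in x..a, ω (2 * y / n) ≤ ∫ y in x..a, Ω :=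
      intervalIntegral.integral_mono_on hxa (ii x a hx ha.le) (by simp) fun y hy => mono y a (hx.trans hy.1) hy.2
    rwa [intervalIntegral.integral_const, smul_eq_mul] at this
  have s2 : ∫ y in a..(π / 2), ω (2 * y / n) ≤ (π ^ 2 / 6 / a - a / 2) * Ω := by
    by_cases h4 : π / 4 ≤ a
    · have : ∫ y in a..(π / 2), ω (2 * y / n) ≤ ∫ y in a..(π / 2), 2 * Ω :=
        intervalIntegral.integral_mono_on ha' (ii a _ ha.le (by positivity)) (by simp) fun y hy =>
          (mono y (2 * a) (ha.le.trans hy.1) (by linarith [hy.2])).trans two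
      rw [intervalIntegral.integral_const, smul_eq_mul] at this
      refine this.trans ?_
      rw [← mul_assoc]
      refine mul_le_mul_of_nonneg_right ?_ hΩ0
      rw [div_div, le_sub_iff_add_le, le_div_iff₀ (by positivity)]
      nlinarith [sq_nonneg (3 * a - π)]
    · push Not at h4
      rw [← intervalIntegral.integral_add_adjacent_intervals (ii a (2 * a) ha.le (by positivity)) (ii (2 * a) (π/2) (by positivity) (by positivity))]
      have t1 : ∫ y in a..(2 * a), ω (2 * y / n) ≤ ∫ y in a..(2 * a), 2 * Ω :=
        intervalIntegral.integral_mono_on (by linarith) (ii a _ ha.le (by positivity)) (by simp) fun y hy =>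
          (mono y (2 * a) (ha.le.trans hy.1) hy.2).trans two
      rw [intervalIntegral.integral_const, smul_eq_mul] at t1
      have t2 : ∫ y in (2 * a)..(π / 2), ω (2 * y / n) ≤ ∫ y in (2 * a)..(π / 2), (1 + y / a) * Ω :=
        intervalIntegral.integral_mono_on (by linarith) (ii _ _ (by positivity) (by positivity))
          (by apply Continuous.intervalIntegrable; fun_prop) fun y hy =>
          rat y (by linarith [hy.1])
      have t3 : ∫ y in (2 * a)..(π / 2), (1 + y / a) * Ω = (π / 2 - 2 * a + (π ^ 2 / 4 - 4 * a ^ 2) / (2 * a)) * Ω := by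
        rw [intervalIntegral.integral_mul_const, intervalIntegral.integral_add (by simp) (by
          apply Continuous.intervalIntegrable; fun_prop), intervalIntegral.integral_div]
        simp only [integral_one, integral_id]
        congr 1
        field_simp; ring
      rw [t3] at t2
      have : (2 * a - a) * 2 + (π / 2 - 2 * a + (π ^ 2 / 4 - 4 * a ^ 2) / (2 * a)) ≤ π ^ 2 / 6 / a - a / 2 := by
        rw [div_div, ← sub_nonneg]
        have : π ^ 2 / (6 * a) - a / 2 - ((2 * a - a) * 2 + (π / 2 - 2 * a + (π ^ 2 / 4 - 4 * a ^ 2) / (2 * a)))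
          = (6 * a - π) ^ 2 / (24 * a) := by field_simp; ring
        rw [this]; positivity
      nlinarith
  linarith

lemma GE_int (hω : IsModulus ω) (hn : 1 ≤ n) {a : ℝ} (ha : 0 < a) (ha' : a ≤ π / 2) :
    8 * ∫ x in (0:ℝ)..a, GE n ω x ≤ π ^ 2 / 6 * ω (2 * a / n) := by
  have hpi := pi_pos
  rw [← intervalIntegral.integral_const_mul]
  have : ∫ x in (0:ℝ)..a, 8 * GE n ω x ≤ ∫ x in (0:ℝ)..a, (a - x + (π ^ 2 / 6 / a - a / 2)) * ω (2 * a / n) := by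
    refine intervalIntegral.integral_mono_on ha.le ?_ ?_ fun x hx => ?_
    · have := GE_cont (n := n) hω
      apply Continuous.intervalIntegrable; fun_prop
    · apply Continuous.intervalIntegrable; fun_prop
    · rw [GE_Icc hx.1 (by linarith [hx.2])]
      exact gg_bound hω hn ha ha' hx.1 hx.2
  refine this.trans (le_of_eq ?_)
  rw [intervalIntegral.integral_mul_const, intervalIntegral.integral_add (by
    apply Continuous.intervalIntegrable; fun_prop) (by simp), intervalIntegral.integral_sub (by simp) (by
    apply Continuous.intervalIntegrable; fun_prop)]
  simp only [intervalIntegral.integral_const, integral_id, smul_eq_mul]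
  congr 1
  field_simp; ring

lemma GE_mod0 (hω : IsModulus ω) (hn : 1 ≤ n) {h : ℝ} (h0 : 0 ≤ h) (h1 : h ≤ π) :
    ∫ x in (-π)..π, |GE n ω (x + h) - GE n ω x| ≤ π ^ 2 / 6 * ω (h / n) := by
  have hpi := pi_pos
  rcases h0.eq_or_lt with rfl | hpos
  · simp [hω.2.2.2.1]
  set a := h / 2 with ha
  have hG := GE_cont (n := n) hω
  have hii : ∀ c d, IntervalIntegrable (GE n ω) volume c d := fun c d => hG.intervalIntegrable c d
  have hF : Continuous (fun x => |GE n ω (x + a) - GE n ω (x - a)|) := by fun_prop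
  have e1 : ∫ x in (-π)..π, |GE n ω (x + h) - GE n ω x| = ∫ x in (-π)..π, |GE n ω (x + a) - GE n ω (x - a)| := by
    have hper : Function.Periodic (fun x => |GE n ω (x + a) - GE n ω (x - a)|) (2 * π) := fun x => by
      beta_reduce
      rw [show x + 2 * π + a = x + a + 2 * π by ring, show x + 2 * π - a = x - a + 2 * π by ring, GE_per, GE_per]
    rw [← per_shift hper a]
    refine intervalIntegral.integral_congr fun x _ => ?_
    beta_reduce
    congr 3
    · rw [ha]; ring
    · ring
  have e2 : ∫ x in (-π)..π, |GE n ω (x + a) - GE n ω (x - a)| = 2 * ∫ x in (0:ℝ)..π, |GE n ω (x + a) - GE n ω (x - a)| := by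
    rw [← intervalIntegral.integral_add_adjacent_intervals (hF.intervalIntegrable (-π) 0) (hF.intervalIntegrable 0 π)]
    have := intervalIntegral.integral_comp_neg (a := 0) (b := π) (fun x => |GE n ω (x + a) - GE n ω (x - a)|)
    rw [neg_zero] at this
    rw [← this, two_mul]
    congr 1
    refine intervalIntegral.integral_congr fun x _ => ?_
    beta_reduce
    rw [show -x + a = -(x - a) by ring, show -x - a = -(x + a) by ring, GE_even, GE_even, abs_sub_comm]
  have e3 : ∫ x in (0:ℝ)..π, |GE n ω (x + a) - GE n ω (x - a)| = ∫ x in (0:ℝ)..π, (GE n ω (x - a) - GE n ω (x + a)) := by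
    refine intervalIntegral.integral_congr fun x hx => ?_
    rw [Set.uIcc_of_le hpi.le] at hx
    beta_reduce
    rw [abs_sub_comm, abs_of_nonneg]
    rw [sub_nonneg]
    unfold GE
    refine gg_mono hω (Real.monotone_arcsin ?_)
    rw [Real.cos_add, Real.cos_sub]
    have s1 := Real.sin_nonneg_of_nonneg_of_le_pi hx.1 hx.2
    have s2 := Real.sin_nonneg_of_nonneg_of_le_pi (by positivity : 0 ≤ a) (by linarith)
    nlinarith [mul_nonneg s1 s2]
  have e4 : ∫ x in (0:ℝ)..π, (GE n ω (x - a) - GE n ω (x + a)) = 4 * ∫ x in (0:ℝ)..a, GE n ω x := by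
    rw [intervalIntegral.integral_sub (by apply Continuous.intervalIntegrable; fun_prop) (by
      apply Continuous.intervalIntegrable; fun_prop), intervalIntegral.integral_comp_sub_right (GE n ω),
      intervalIntegral.integral_comp_add_right (GE n ω)]
    have a1 := intervalIntegral.integral_add_adjacent_intervals (hii (0 - a) a) (hii a (π - a))
    have a2 := intervalIntegral.integral_add_adjacent_intervals (hii (0 + a) (π - a)) (hii (π - a) (π + a))
    have a3 := intervalIntegral.integral_add_adjacent_intervals (hii (0 - a) 0) (hii 0 a)
    have a4 : ∫ x in (0 - a)..0, GE n ω x = ∫ x in (0:ℝ)..a, GE n ω x := by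
      have := intervalIntegral.integral_comp_neg (a := 0) (b := a) (GE n ω)
      rw [neg_zero] at this
      rw [zero_sub, ← this]
      refine intervalIntegral.integral_congr fun x _ => GE_even x
    have a5 : ∫ x in (π - a)..(π + a), GE n ω x = - ∫ x in (0 - a)..a, GE n ω x := by
      have := intervalIntegral.integral_comp_add_right (a := 0 - a) (b := a) (GE n ω) π
      rw [show 0 - a + π = π - a by ring, show a + π = π + a by ring] at this
      rw [← this, ← intervalIntegral.integral_neg]
      refine intervalIntegral.integral_congr fun x _ => GE_anti x
    rw [zero_add] at a2 ⊢
    linarith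
  rw [e1, e2, e3, e4]
  have := GE_int hω hn (a := a) (by positivity) (by linarith)
  rw [show 2 * a / n = h / n by rw [ha]; ring] at this
  linarith

lemma GE_mod (hω : IsModulus ω) (hn : 1 ≤ n) (h : ℝ) :
    ∫ x in (-π)..π, |GE n ω (x + h) - GE n ω x| ≤ π ^ 2 / 6 * ω (|h| / n) := by
  have hn' : (0 : ℝ) < n := by positivity
  set h' := Real.arccos (Real.cos h) with hh'
  have h0 : 0 ≤ h' := Real.arccos_nonneg _
  have h1 : h' ≤ π := Real.arccos_le_pi _
  have hle : h' ≤ |h| := by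
    rcases le_total |h| π with hp | hp
    · rw [hh', ← Real.cos_abs, Real.arccos_cos (abs_nonneg _) hp]
    · exact h1.trans hp
  have hc : Real.cos h' = Real.cos h := by
    rw [hh', Real.cos_arccos (Real.neg_one_le_cos _) (Real.cos_le_one _)]
  have key : ∫ x in (-π)..π, |GE n ω (x + h) - GE n ω x| = ∫ x in (-π)..π, |GE n ω (x + h') - GE n ω x| := by
    rw [Real.cos_eq_cos_iff] at hc
    obtain ⟨k, hk | hk⟩ := hc
    · refine intervalIntegral.integral_congr fun x _ => ?_
      beta_reduce
      rw [hk, show x + (2 * k * π + h') = x + h' + k * (2 * π) by ring, (GE_per (n := n) (ω := ω)).int_mul k]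
    · have hper : Function.Periodic (fun x => |GE n ω (x + h') - GE n ω x|) (2 * π) := fun x => by
        beta_reduce
        rw [show x + 2 * π + h' = x + h' + 2 * π by ring, GE_per, GE_per]
      rw [← per_shift hper (-h')]
      refine intervalIntegral.integral_congr fun x _ => ?_
      beta_reduce
      rw [hk, show x + (2 * k * π - h') = x + -h' + k * (2 * π) by ring, (GE_per (n := n) (ω := ω)).int_mul k,
        neg_add_cancel_right, abs_sub_comm]
  rw [key]
  refine (GE_mod0 hω hn h0 h1).trans ?_
  refine mul_le_mul_of_nonneg_left (hω.2.1 (Set.mem_Ici.mpr (by positivity)) (Set.mem_Ici.mpr (by positivity)) ?_) (by positivity)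
  gcongr

lemma GE_cos (hω : IsModulus ω) (hn : 1 ≤ n) : ∫ x in (-π)..π, GE n ω x * Real.cos x = eN n ω / 2 := by
  have hpi := pi_pos
  have hG := GE_cont (n := n) hω
  have hg := gg_cont (n := n) hω
  have hp := pp_cont (n := n) hω
  have hc : Continuous (fun x => GE n ω x * Real.cos x) := by fun_prop
  have e1 : ∫ x in (-π)..π, GE n ω x * Real.cos x = 2 * ∫ x in (0:ℝ)..π, GE n ω x * Real.cos x := by
    rw [← intervalIntegral.integral_add_adjacent_intervals (hc.intervalIntegrable (-π) 0) (hc.intervalIntegrable 0 π)]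
    have := intervalIntegral.integral_comp_neg (a := 0) (b := π) (fun x => GE n ω x * Real.cos x)
    rw [neg_zero] at this
    rw [← this, two_mul]
    congr 1
    refine intervalIntegral.integral_congr fun x _ => ?_
    beta_reduce
    rw [GE_even, Real.cos_neg]
  have e2 : ∫ x in (0:ℝ)..π, GE n ω x * Real.cos x = ∫ y in (-(π/2))..(π / 2), gg n ω y * Real.sin y := by
    have := intervalIntegral.integral_comp_sub_left (a := 0) (b := π) (fun y => gg n ω y * Real.sin y) (π / 2)
    rw [sub_zero, show π / 2 - π = -(π / 2) by ring] at this
    rw [← this]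
    refine intervalIntegral.integral_congr fun x hx => ?_
    rw [Set.uIcc_of_le hpi.le] at hx
    beta_reduce
    rw [GE_Icc hx.1 hx.2, Real.sin_pi_div_two_sub]
  have e3 : ∫ y in (-(π/2))..(π / 2), gg n ω y * Real.sin y = ∫ y in (-(π/2))..(π / 2), 1 / 8 * pp n ω y * Real.cos y := by
    have := intervalIntegral.integral_mul_deriv_eq_deriv_mul (a := -(π/2)) (b := π / 2) (u := gg n ω) (v := fun y => - Real.cos y)
      (u' := fun y => 1 / 8 * pp n ω y) (v' := Real.sin) (fun y _ => gg_deriv hω y)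
      (fun y _ => by have := (Real.hasDerivAt_cos y).neg; rw [neg_neg] at this; exact this)
      (by apply Continuous.intervalIntegrable; fun_prop) (by apply Continuous.intervalIntegrable; fun_prop)
    rw [this]
    simp
  have hq : Continuous (fun y => 1 / 8 * pp n ω y * Real.cos y) := by fun_prop
  have e4 : ∫ y in (-(π/2))..(π / 2), 1 / 8 * pp n ω y * Real.cos y = 2 * ∫ y in (0:ℝ)..(π / 2), 1 / 8 * pp n ω y * Real.cos y := by
    rw [← intervalIntegral.integral_add_adjacent_intervals (hq.intervalIntegrable (-(π/2)) 0) (hq.intervalIntegrable 0 (π/2))]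
    have := intervalIntegral.integral_comp_neg (a := 0) (b := π / 2) (fun x => 1 / 8 * pp n ω x * Real.cos x)
    rw [neg_zero] at this
    rw [← this, two_mul]
    congr 1
    refine intervalIntegral.integral_congr fun x _ => ?_
    simp only [pp]
    rw [abs_neg, Real.cos_neg]
  have e5 : ∫ y in (0:ℝ)..(π / 2), 1 / 8 * pp n ω y * Real.cos y = 1 / 8 * eN n ω := by
    unfold eN
    rw [← intervalIntegral.integral_const_mul]
    have := intervalIntegral.integral_comp_sub_left (a := 0) (b := π / 2) (fun y => 1 / 8 * pp n ω y * Real.cos y) (π / 2)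
    rw [sub_zero, sub_self] at this
    rw [← this]
    refine intervalIntegral.integral_congr fun x hx => ?_
    rw [Set.uIcc_of_le (by positivity)] at hx
    simp only [pp]
    rw [Real.cos_pi_div_two_sub, abs_of_nonneg (by linarith [hx.2] : 0 ≤ π / 2 - x), abs_of_nonneg (by linarith [hx.1]),
      show π - 2 * (π / 2 - x) = 2 * x by ring]
    ring
  rw [e1, e2, e3, e4, e5]; ring

lemma GE_abs (hω : IsModulus ω) (hn : 1 ≤ n) (x : ℝ) : |GE n ω x| ≤ π / 16 * ((1 + π) * ω (1 / n)) := by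
  have hpi := pi_pos
  have hn' : (0 : ℝ) < n := by positivity
  have hb : gg n ω (π / 2) ≤ π / 16 * ((1 + π) * ω (1 / n)) := by
    unfold gg
    have : ∫ v in (0:ℝ)..(π / 2), pp n ω v ≤ ∫ v in (0:ℝ)..(π / 2), (1 + π) * ω (1 / n) := by
      refine intervalIntegral.integral_mono_on (by positivity) ((pp_cont hω).intervalIntegrable _ _) (by simp) fun v hv => ?_
      unfold pp
      have h0 := hv.1
      have h1 := hv.2
      refine (mod_ratio hω (s := 1 / n) (by positivity) (by positivity)).trans ?_
      refine mul_le_mul_of_nonneg_right ?_ (hω.2.2.2.2 _ (by positivity))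
      rw [abs_of_nonneg h0, abs_of_nonneg (by linarith)]
      have : (π - 2 * v) / n / (1 / n) = π - 2 * v := by field_simp
      rw [this]; linarith
    rw [intervalIntegral.integral_const, smul_eq_mul, sub_zero] at this
    linarith
  rw [abs_le]
  unfold GE
  constructor
  · have := gg_mono (n := n) hω (Real.neg_pi_div_two_le_arcsin (Real.cos x))
    rw [gg_odd] at this
    linarith
  · exact (gg_mono (n := n) hω (Real.arcsin_le_pi_div_two (Real.cos x))).trans hb

end ext

lemma orth_ne {a m : ℕ} (h : a ≠ m) (θ α : ℝ) :
    ∫ t in (-π)..π, Real.cos (a * t - θ) * Real.cos (m * t - α) = 0 := by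
  have e : ∀ t, Real.cos (a * t - θ) * Real.cos (m * t - α)
      = 1 / 2 * (Real.cos (((a - m : ℤ) : ℝ) * t + (α - θ)) + Real.cos (((a + m : ℤ) : ℝ) * t + (-θ - α))) := fun t => by
    push_cast
    rw [show ((a : ℝ) - m) * t + (α - θ) = (a * t - θ) - (m * t - α) by ring,
      show ((a : ℝ) + m) * t + (-θ - α) = (a * t - θ) + (m * t - α) by ring, Real.cos_sub (a * t - θ), Real.cos_add (a * t - θ)]
    ring
  simp_rw [e]
  rw [intervalIntegral.integral_const_mul, intervalIntegral.integral_add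
    (by apply Continuous.intervalIntegrable; fun_prop) (by apply Continuous.intervalIntegrable; fun_prop),
    int_cos_int _ (by omega), int_cos_int _ (by omega)]
  simp

lemma orth_eq {m : ℕ} (h : 1 ≤ m) (θ α : ℝ) :
    ∫ t in (-π)..π, Real.cos (m * t - θ) * Real.cos (m * t - α) = π * Real.cos (θ - α) := by
  have e : ∀ t, Real.cos (m * t - θ) * Real.cos (m * t - α)
      = 1 / 2 * (Real.cos (θ - α) + Real.cos (((m + m : ℤ) : ℝ) * t + (-θ - α))) := fun t => by
    push_cast
    rw [← Real.cos_neg (θ - α), show -(θ - α) = (m * t - θ) - (m * t - α) by ring,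
      show ((m : ℝ) + m) * t + (-θ - α) = (m * t - θ) + (m * t - α) by ring, Real.cos_sub (m * t - θ), Real.cos_add (m * t - θ)]
    ring
  simp_rw [e]
  rw [intervalIntegral.integral_const_mul, intervalIntegral.integral_add
    (by apply Continuous.intervalIntegrable; fun_prop) (by apply Continuous.intervalIntegrable; fun_prop),
    int_cos_int _ (by omega)]
  simp
  ring

lemma trig_orth {n m : ℕ} (hm : n ≤ m) {T : ℝ → ℝ} (hT : IsTrigPoly n T) (α : ℝ) :
    ∫ x in (-π)..π, T x * Real.cos (m * x - α) = 0 := by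
  obtain ⟨a, b, h⟩ := hT
  have e : ∀ x, T x * Real.cos (m * x - α) = ∑ k ∈ Finset.range n,
      (a k * (Real.cos (k * x - 0) * Real.cos (m * x - α)) + b k * (Real.cos (k * x - π / 2) * Real.cos (m * x - α))) := fun x => by
    rw [h, Finset.sum_mul]
    refine Finset.sum_congr rfl fun k _ => ?_
    rw [Real.cos_sub_pi_div_two, sub_zero]; ring
  simp_rw [e]
  rw [intervalIntegral.integral_finsetSum fun k _ => by apply Continuous.intervalIntegrable; fun_prop]
  refine Finset.sum_eq_zero fun k hk => ?_
  have hk := Finset.mem_range.mp hk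
  rw [intervalIntegral.integral_add (by apply Continuous.intervalIntegrable; fun_prop)
    (by apply Continuous.intervalIntegrable; fun_prop), intervalIntegral.integral_const_mul,
    intervalIntegral.integral_const_mul, orth_ne (by omega), orth_ne (by omega)]
  simp

lemma psi_coef {ψ : ℝ → ℝ} (hpos : ∀ t ≥ (1:ℝ), 0 < ψ t)
    (hs : Summable (fun k : ℕ => ψ ((k : ℝ) + 1))) (β : ℝ) {m : ℕ} (hm : 1 ≤ m) (α : ℝ) :
    ∫ t in (-π)..π, PsiKer ψ β t * Real.cos (m * t - α) = π * ψ m * Real.cos (β * π / 2 - α) := by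
  have hk : ∀ k : ℕ, 0 < ψ ((k : ℝ) + 1) := fun k => hpos _ (by linarith [(Nat.cast_nonneg k : (0:ℝ) ≤ k)])
  have H := intervalIntegral.hasSum_integral_of_dominated_convergence (μ := volume) (a := -π) (b := π)
    (F := fun (k : ℕ) t => ψ ((k : ℝ) + 1) * Real.cos ((k + 1) * t - β * π / 2) * Real.cos (m * t - α))
    (f := fun t => PsiKer ψ β t * Real.cos (m * t - α))
    (fun k _ => ψ ((k : ℝ) + 1))
    (fun k => by apply Continuous.aestronglyMeasurable; fun_prop)
    (fun k => Eventually.of_forall fun t _ => by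
      rw [Real.norm_eq_abs, abs_mul, abs_mul, abs_of_pos (hk k), mul_assoc]
      exact mul_le_of_le_one_right (hk k).le
        (mul_le_one₀ (abs_cos_le_one _) (abs_nonneg _) (abs_cos_le_one _)))
    (Eventually.of_forall fun t _ => hs) (by simp)
    (Eventually.of_forall fun t _ => (psiKer_summable hpos hs _ t).hasSum.mul_right _)
  have h1 : ∀ k : ℕ, k ≠ m - 1 → (∫ t in (-π)..π, ψ ((k : ℝ) + 1) * Real.cos ((k + 1) * t - β * π / 2) * Real.cos (m * t - α)) = 0 := by
    intro k hkm
    simp_rw [mul_assoc (ψ ((k : ℝ) + 1))]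
    rw [intervalIntegral.integral_const_mul]
    have := orth_ne (a := k + 1) (m := m) (by omega) (β * π / 2) α
    push_cast at this
    rw [this, mul_zero]
  have H2 := hasSum_single (m - 1) h1
  rw [H.unique H2]
  have e : ((m - 1 : ℕ) : ℝ) + 1 = m := by
    have : m - 1 + 1 = m := by omega
    exact_mod_cast this
  simp_rw [e, mul_assoc (ψ (m : ℝ))]
  rw [intervalIntegral.integral_const_mul, orth_eq hm]
  ring

lemma cv_coef {φ K : ℝ → ℝ} (h : PI φ) (hev : ∀ x, φ (-x) = φ x) (hK : Nice K) (m : ℕ) (α : ℝ) :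
    ∫ x in (-π)..π, cv φ K x * Real.cos (m * x - α)
      = (∫ u in (-π)..π, φ u * Real.cos (m * u)) * ∫ t in (-π)..π, K t * Real.cos (m * t - α) := by
  have hcp : ∀ c : ℝ, Function.Periodic (fun x => Real.cos (m * x - c)) (2 * π) := fun c x => by
    beta_reduce
    rw [show (m : ℝ) * (x + 2 * π) - c = m * x - c + m * (2 * π) by ring, Real.cos_add_nat_mul_two_pi]
  have hn : Nice (fun x => Real.cos (m * x)) := by simpa using Nice.cos (m : ℝ) 0
  have hn2 : Nice (fun x => Real.sin (m * x)) := by simpa [Real.cos_sub_pi_div_two] using Nice.cos (m : ℝ) (π / 2)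
  have hodd : ∫ u in (-π)..π, φ u * Real.sin (m * u) = 0 := by
    have hper : Function.Periodic (fun u => φ u * Real.sin (m * u)) (2 * π) := fun x => by
      beta_reduce
      rw [h.per, show (m : ℝ) * (x + 2 * π) = m * x + m * (2 * π) by ring, Real.sin_add_nat_mul_two_pi]
    have := per_refl hper 0
    have e : ∀ x, φ (0 - x) * Real.sin (m * (0 - x)) = -(φ x * Real.sin (m * x)) := fun x => by
      rw [zero_sub, hev, mul_neg, Real.sin_neg]; ring
    simp_rw [e] at this
    rw [intervalIntegral.integral_neg] at this
    linarith
  have inner : ∀ t, ∫ x in (-π)..π, φ (x - t) * K t * Real.cos (m * x - α)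
      = (∫ u in (-π)..π, φ u * Real.cos (m * u)) * (K t * Real.cos (m * t - α)) := fun t => by
    have hper : Function.Periodic (fun x => φ (x - t) * K t * Real.cos (m * x - α)) (2 * π) := fun x => by
      have := hcp α x
      beta_reduce at this ⊢
      rw [this, show x + 2 * π - t = x - t + 2 * π by ring, h.per]
    rw [← per_shift hper t]
    have e : ∀ x, φ (x + t - t) * K t * Real.cos (m * (x + t) - α)
        = (K t * Real.cos (m * t - α)) * (φ x * Real.cos (m * x)) - (K t * Real.sin (m * t - α)) * (φ x * Real.sin (m * x)) := fun x => by
      rw [add_sub_cancel_right, show (m : ℝ) * (x + t) - α = m * x + (m * t - α) by ring, Real.cos_add]; ring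
    simp_rw [e]
    rw [intervalIntegral.integral_sub ((h.mul_nice' hn _ _).const_mul _) ((h.mul_nice' hn2 _ _).const_mul _),
      intervalIntegral.integral_const_mul, intervalIntegral.integral_const_mul, hodd]
    ring
  have hi : Integrable (Function.uncurry fun x t : ℝ => φ (x - t) * K t * Real.cos (m * x - α))
      ((volume.restrict (Set.Ioc (-π) π)).prod (volume.restrict (Set.Ioc (-π) π))) := by
    refine (cv_prod h hK).mul_bdd (c := 1) ?_ ?_
    · apply Continuous.aestronglyMeasurable; fun_prop
    · exact Eventually.of_forall fun p => by simpa using abs_cos_le_one _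
  have sw : ∫ x in (-π)..π, ∫ t in (-π)..π, φ (x - t) * K t * Real.cos (m * x - α)
      = ∫ t in (-π)..π, ∫ x in (-π)..π, φ (x - t) * K t * Real.cos (m * x - α) := by
    simp only [intervalIntegral.integral_of_le negpi_le]
    exact integral_integral_swap hi
  simp_rw [inner] at sw
  rw [intervalIntegral.integral_const_mul] at sw
  rw [← sw]
  unfold cv
  simp_rw [intervalIntegral.integral_mul_const]

lemma lower {ω : ℝ → ℝ} (hω : IsModulus ω) {ψ η : ℝ → ℝ}
    (hψ : IsMInfPlus ψ η) {n : ℕ} (hn : 1 ≤ n)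
    (hμ : 2 < (n : ℝ) / (η n - n)) (β : ℝ) :
    ∃ f ∈ L1Class ψ β ω, (1 / π) * ψ n * eN n ω - gammaN ψ η n * ω (1 / n) ≤ EnL1 n f := by
  have hpi := pi_pos
  have hn1 : (1 : ℝ) ≤ n := by exact_mod_cast hn
  have hn' : (0 : ℝ) < n := by linarith
  have hω1 : 0 ≤ ω (1 / n) := hω.2.2.2.2 _ (by positivity)
  have he0 := eN_nonneg hω n
  have hpos := hψ.1
  have hs := psi_summable hψ hn hμ
  obtain ⟨-, hg1, hg0⟩ := gamma_bd hψ hn hμ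
  have hG := GE_cont (n := n) hω
  set c : ℝ := 6 / π ^ 2 with hc
  have hc0 : 0 < c := by positivity
  set φ : ℝ → ℝ := fun x => c * GE n ω (n * x) with hφ
  have hφc : Continuous φ := by fun_prop
  have hφper : Function.Periodic φ (2 * π) := fun x => by
    simp only [hφ]
    rw [mul_add, (GE_per (n := n) (ω := ω)).nat_mul n]
  have hφe : ∀ x, φ (-x) = φ x := fun x => by
    simp only [hφ]
    rw [mul_neg, GE_even]
  have hPI : PI φ := ⟨hφc.intervalIntegrable _ _, hφper⟩
  have hφ0 : ∫ t in (-π)..π, φ t = 0 := by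
    simp only [hφ]
    rw [intervalIntegral.integral_const_mul, per_scale GE_per (fun a b => hG.intervalIntegrable a b) hn]
    have := per_shift (GE_per (n := n) (ω := ω)) π
    simp_rw [GE_anti] at this
    rw [intervalIntegral.integral_neg] at this
    rw [show ∫ x in (-π)..π, GE n ω x = 0 by linarith, mul_zero]
  have hφm : ∀ t : ℝ, 0 ≤ t → ∀ h : ℝ, |h| ≤ t → (∫ x in (-π)..π, |φ (x + h) - φ x|) ≤ ω t := by
    intro t ht h hh
    have e : ∀ x, |φ (x + h) - φ x| = c * |GE n ω (n * x + n * h) - GE n ω (n * x)| := fun x => by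
      simp only [hφ]
      rw [← mul_sub, abs_mul, abs_of_pos hc0, mul_add]
    simp_rw [e]
    have hper : Function.Periodic (fun y => |GE n ω (y + n * h) - GE n ω y|) (2 * π) := fun x => by
      beta_reduce
      rw [show x + 2 * π + n * h = x + n * h + 2 * π by ring, GE_per, GE_per]
    have hcc : Continuous (fun y => |GE n ω (y + n * h) - GE n ω y|) := by fun_prop
    rw [intervalIntegral.integral_const_mul, per_scale hper (fun a b => hcc.intervalIntegrable a b) hn]
    have := mul_le_mul_of_nonneg_left (GE_mod hω hn (n * h)) hc0.le
    refine this.trans ?_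
    have e2 : c * (π ^ 2 / 6 * ω (|n * h| / n)) = ω |h| := by
      rw [abs_mul, abs_of_pos hn', mul_div_cancel_left₀ _ hn'.ne', hc]; field_simp
    rw [e2]
    exact hω.2.1 (Set.mem_Ici.mpr (abs_nonneg _)) (Set.mem_Ici.mpr ht) hh
  have hK := psiKer_nice hpos hs β
  have hcv := cv_PI hPI hK
  set f : ℝ → ℝ := fun x => 1 / π * cv φ (PsiKer ψ β) x with hf
  have hfPI : PI f := ⟨hcv.ii.const_mul _, fun x => by simp only [hf]; rw [hcv.per]⟩
  refine ⟨f, ⟨hfPI.ii, hfPI.per, 0, φ, hPI.ii, hφper, hφ0, hφm, Eventually.of_forall fun x => by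
    simp only [hf, cv]; ring⟩, ?_⟩
  set θ := β * π / 2 with hθ
  -- coefficients
  have coef : ∀ m : ℕ, 1 ≤ m → ∀ α, ∫ x in (-π)..π, f x * Real.cos (m * x - α)
      = (∫ u in (-π)..π, φ u * Real.cos (m * u)) * (ψ m * Real.cos (θ - α)) := fun m hm α => by
    simp only [hf]
    simp_rw [mul_assoc (1 / π)]
    rw [intervalIntegral.integral_const_mul, cv_coef hPI hφe hK, psi_coef hpos hs β hm, ← hθ]
    field_simp
  have Cn : ∫ u in (-π)..π, φ u * Real.cos (n * u) = c * (eN n ω / 2) := by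
    have hper : Function.Periodic (fun y => GE n ω y * Real.cos y) (2 * π) := fun x => by
      beta_reduce
      rw [GE_per, Real.cos_add_two_pi]
    have hcc : Continuous (fun y => GE n ω y * Real.cos y) := by fun_prop
    rw [← GE_cos hω hn, ← per_scale hper (fun a b => hcc.intervalIntegrable a b) hn,
      ← intervalIntegral.integral_const_mul]
    refine intervalIntegral.integral_congr fun x _ => ?_
    simp only [hφ]; ring
  have C3n : |∫ u in (-π)..π, φ u * Real.cos ((3 * n : ℕ) * u)| ≤ 4 * ω (1 / n) := by
    have := intervalIntegral.norm_integral_le_of_norm_le_const (a := -π) (b := π)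
      (f := fun u => φ u * Real.cos ((3 * n : ℕ) * u)) (C := c * (π / 16 * ((1 + π) * ω (1 / n)))) fun u _ => by
        rw [Real.norm_eq_abs, abs_mul]
        refine (mul_le_of_le_one_right (abs_nonneg _) (abs_cos_le_one _)).trans ?_
        simp only [hφ]
        rw [abs_mul, abs_of_pos hc0]
        exact mul_le_mul_of_nonneg_left (GE_abs hω hn _) hc0.le
    rw [Real.norm_eq_abs, show |π - -π| = 2 * π by rw [sub_neg_eq_add, ← two_mul]; exact abs_of_pos (by positivity)] at this
    refine this.trans ?_
    rw [show c * (π / 16 * ((1 + π) * ω (1 / n))) * (2 * π) = 3 / 4 * (1 + π) * ω (1 / n) by rw [hc]; field_simp; ring]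
    refine mul_le_mul_of_nonneg_right ?_ hω1
    linarith [Real.pi_lt_d2]
  have hHc : ∀ x : ℝ, |9 / 8 * Real.cos (n * x - θ) - 1 / 8 * Real.cos ((3 * n : ℕ) * x - 3 * θ)| ≤ 1 := fun x => by
    rw [show ((3 * n : ℕ) : ℝ) * x - 3 * θ = 3 * (n * x - θ) by push_cast; ring, Real.cos_three_mul]
    set y := Real.cos (n * x - θ)
    have h1 : y ≤ 1 := Real.cos_le_one _
    have h2 : -1 ≤ y := Real.neg_one_le_cos _
    rw [abs_le]
    constructor
    · nlinarith [mul_nonneg (sq_nonneg (y + 1)) (by linarith : 0 ≤ 2 - y)]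
    · nlinarith [mul_nonneg (sq_nonneg (y - 1)) (by linarith : 0 ≤ 2 + y)]
  have hψn := hpos n hn1
  have hψ3 := hpos (3 * n) (by linarith)
  unfold EnL1
  refine le_csInf ⟨_, _, IsTrigPoly.zero, rfl⟩ ?_
  rintro e ⟨T, hT, rfl⟩
  have hTPI := PI.of_trig hT
  have hd := hfPI.sub hTPI
  have hNn : Nice (fun x => Real.cos (n * x - θ)) := Nice.cos n θ
  have hN3 : Nice (fun x => Real.cos ((3 * n : ℕ) * x - 3 * θ)) := Nice.cos _ _
  have orthT : ∀ m : ℕ, n ≤ m → ∀ α, ∫ x in (-π)..π, (f x - T x) * Real.cos (m * x - α) = ∫ x in (-π)..π, f x * Real.cos (m * x - α) := fun m hm α => by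
    simp_rw [sub_mul]
    rw [intervalIntegral.integral_sub (hfPI.mul_nice' (Nice.cos m α) _ _) (hTPI.mul_nice' (Nice.cos m α) _ _), trig_orth hm hT, sub_zero]
  have key : ∫ x in (-π)..π, (f x - T x) * (9 / 8 * Real.cos (n * x - θ) - 1 / 8 * Real.cos ((3 * n : ℕ) * x - 3 * θ))
      = 9 / 8 * (c * (eN n ω / 2)) * ψ n
        - 1 / 8 * (∫ u in (-π)..π, φ u * Real.cos ((3 * n : ℕ) * u)) * (ψ (3 * n) * Real.cos (θ - 3 * θ)) := by
    have e : ∀ x, (f x - T x) * (9 / 8 * Real.cos (n * x - θ) - 1 / 8 * Real.cos ((3 * n : ℕ) * x - 3 * θ))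
      = 9 / 8 * ((f x - T x) * Real.cos (n * x - θ)) - 1 / 8 * ((f x - T x) * Real.cos ((3 * n : ℕ) * x - 3 * θ)) := fun x => by ring
    simp_rw [e]
    rw [intervalIntegral.integral_sub ((hd.mul_nice' hNn _ _).const_mul _) ((hd.mul_nice' hN3 _ _).const_mul _),
      intervalIntegral.integral_const_mul, intervalIntegral.integral_const_mul, orthT n le_rfl, orthT (3 * n) (by omega),
      coef n hn, coef (3 * n) (by omega), Cn, sub_self, Real.cos_zero]
    push_cast
    ring
  have up : ∫ x in (-π)..π, (f x - T x) * (9 / 8 * Real.cos (n * x - θ) - 1 / 8 * Real.cos ((3 * n : ℕ) * x - 3 * θ))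
      ≤ ∫ x in (-π)..π, |f x - T x| := by
    refine intervalIntegral.integral_mono_on negpi_le (hd.mul_nice' ⟨by fun_prop, 1, hHc⟩ _ _) hd.ii.abs fun x _ => ?_
    refine (le_abs_self _).trans ?_
    rw [abs_mul]
    exact mul_le_of_le_one_right (abs_nonneg _) (hHc x)
  rw [key] at up
  refine le_trans ?_ up
  have a1 : 1 / π * ψ n * eN n ω ≤ 9 / 8 * (c * (eN n ω / 2)) * ψ n := by
    rw [show 9 / 8 * (c * (eN n ω / 2)) * ψ n = 9 / 16 * c * (ψ n * eN n ω) by ring, mul_assoc]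
    refine mul_le_mul_of_nonneg_right ?_ (by positivity)
    rw [hc, show 9 / 16 * (6 / π ^ 2) = 27 / (8 * π) * (1 / π) by field_simp; ring]
    refine le_mul_of_one_le_left (by positivity) ?_
    rw [le_div_iff₀ (by positivity)]
    linarith [Real.pi_lt_d2]
  have a2 : 1 / 8 * (∫ u in (-π)..π, φ u * Real.cos ((3 * n : ℕ) * u)) * (ψ (3 * n) * Real.cos (θ - 3 * θ)) ≤ gammaN ψ η n * ω (1 / n) := by
    refine (le_abs_self _).trans ?_
    rw [abs_mul, abs_mul, abs_mul, abs_of_pos hψ3]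
    have b1 : ψ (3 * n) * |Real.cos (θ - 3 * θ)| ≤ gammaN ψ η n :=
      (mul_le_of_le_one_right hψ3.le (abs_cos_le_one _)).trans hg1
    have b2 : |(1 : ℝ) / 8| * |∫ u in (-π)..π, φ u * Real.cos ((3 * n : ℕ) * u)| ≤ ω (1 / n) := by
      rw [abs_of_pos (by norm_num)]
      linarith
    calc _ ≤ ω (1 / n) * gammaN ψ η n := mul_le_mul b2 b1 (by positivity) hω1
      _ = _ := mul_comm _ _
  linarith

/-- For arbitrary moduli of continuity, two-sided estimate for
`E_n(L^ψ_β H_{ω_{L₁}})_{L₁}` whenever `μ(n) > 2`. -/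
theorem statement3 :
    ∃ K : ℝ, 0 < K ∧ ∀ ψ η : ℝ → ℝ, IsMInfPlus ψ η → ∀ β : ℝ, ∀ ω : ℝ → ℝ,
      IsModulus ω → ∀ n : ℕ,
      2 < (n : ℝ) / (η n - n) →
      (1 / π) * ψ n * eN n ω - K * gammaN ψ η n * ω (1 / n) ≤
          EnL1Class n (L1Class ψ β ω) ∧
        EnL1Class n (L1Class ψ β ω) ≤
          (2 / π) * ψ n * eN n ω + K * gammaN ψ η n * ω (1 / n) := by
  have h6 := C6_pos
  refine ⟨C6 + 1, by linarith, fun ψ η hψ β ω hω n hμ => ?_⟩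
  have hn : 1 ≤ n := by
    by_contra h
    have : n = 0 := by omega
    subst this
    norm_num at hμ
  have hω1 : 0 ≤ ω (1 / n) := hω.2.2.2.2 _ (by positivity)
  obtain ⟨-, -, hg0⟩ := gamma_bd hψ hn hμ
  have hp : 0 ≤ gammaN ψ η n * ω (1 / n) := by positivity
  have hp2 : 0 ≤ C6 * (gammaN ψ η n * ω (1 / n)) := by positivity
  obtain ⟨f, hf, hlow⟩ := lower hω hψ hn hμ β
  have hub : ∀ e ∈ EnL1 n '' L1Class ψ β ω, e ≤ (2 / π) * ψ n * eN n ω + C6 * gammaN ψ η n * ω (1 / n) := by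
    rintro e ⟨g, hg, rfl⟩
    exact upper hω hψ hn hμ β hg
  constructor
  · refine le_trans ?_ (le_csSup ⟨_, hub⟩ ⟨f, hf, rfl⟩)
    linarith
  · have hne : (EnL1 n '' L1Class ψ β ω).Nonempty := ⟨_, f, hf, rfl⟩
    refine (csSup_le hne hub).trans ?_
    linarith
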